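/- Fix i ∈ {1,2}. There exist constants M ≥ 1 and ε₀ > 0, and for each ε ∈ (0,ε₀) a constant δ₁(ε) ∈ (0,1), such that the following holds for every ε ∈ (0,ε₀), every δ ∈ (0, δ₁(ε)], and every subset A ⊆ B^{𝔯ᵢ}_1(0): the set ℰ(A) = {u ∈ 𝖡₁ᵁ : there exists A' ⊆ A with |A'|_δ ≥ δ^ε·|A|_δ and |π^{(1)}_u(A')|_δ < δ^{Mε}·|A|_δ^{1/3}} satisfies m_U(ℰ(A)) ≤ δ^ε. -/

import Mathlib

open Matrix MeasureTheory
open scoped Classical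

noncomputable section

abbrev M4 : Type := Matrix (Fin 4) (Fin 4) ℝ

/-- trace inner product ⟨X,Y⟩ = tr(XYᵀ) -/
def tinner (X Y : M4) : ℝ := (X * Yᵀ).trace

/-- sup norm: maximum absolute value of entries -/
def mnorm (X : M4) : ℝ := ⨆ p : Fin 4 × Fin 4, |X p.1 p.2|

/-- Euclidean (Frobenius) norm -/
def mnorm2 (X : M4) : ℝ := Real.sqrt (tinner X X)

/-- Gram matrices Q₁ (i=0) and Q₂ (i=1) -/
def Qmat (i : Fin 2) : M4 :=
  if i = 0 then !![0,0,0,-(1/2); 0,0,1/2,0; 0,1/2,0,0; -(1/2),0,0,0]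
  else !![0,0,0,-1; 0,1,0,0; 0,0,1,0; -1,0,0,0]

/-- 𝔰𝔩₄(ℝ) as a submodule of 4×4 matrices -/
def sl4 : Submodule ℝ M4 where
  carrier := {X | X.trace = 0}
  add_mem' := by
    intro a b ha hb
    simp only [Set.mem_setOf_eq] at *
    simp [Matrix.trace_add, ha, hb]
  zero_mem' := by simp
  smul_mem' := by
    intro c x hx
    simp only [Set.mem_setOf_eq] at *
    simp [Matrix.trace_smul, hx]

/-- the involution σᵢ(X) = −QᵢXᵀQᵢ⁻¹ as a linear map -/
def sigmaMap (i : Fin 2) : M4 →ₗ[ℝ] M4 where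
  toFun X := -(Qmat i * Xᵀ * (Qmat i)⁻¹)
  map_add' X Y := by
    simp [Matrix.transpose_add, add_mul, mul_add]; abel
  map_smul' c X := by
    simp [Matrix.transpose_smul, Matrix.smul_mul, Matrix.mul_smul]

/-- 𝔯ᵢ = {X ∈ 𝔰𝔩₄ : σᵢ(X) = −X} -/
def rSpace (i : Fin 2) : Submodule ℝ M4 :=
  sl4 ⊓ LinearMap.ker (sigmaMap i + (LinearMap.id : M4 →ₗ[ℝ] M4))

/-- 𝔥ᵢ = {X ∈ 𝔰𝔩₄ : σᵢ(X) = X} -/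
def hSpace (i : Fin 2) : Submodule ℝ M4 :=
  sl4 ⊓ LinearMap.ker (sigmaMap i - (LinearMap.id : M4 →ₗ[ℝ] M4))

/-- 𝐚 = diag(1,0,0,−1) -/
def aWt : M4 := Matrix.diagonal ![1,0,0,-1]

/-- ad(𝐚) = [𝐚, ·] -/
def adA : M4 →ₗ[ℝ] M4 where
  toFun X := aWt * X - X * aWt
  map_add' X Y := by simp [mul_add, add_mul]; abel
  map_smul' c X := by simp [Matrix.mul_smul, Matrix.smul_mul, smul_sub]

/-- weight space (𝔯ᵢ)_λ -/
def wSpace (i : Fin 2) (lam : ℤ) : Submodule ℝ M4 :=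
  rSpace i ⊓ LinearMap.ker (adA - (lam : ℝ) • (LinearMap.id : M4 →ₗ[ℝ] M4))

/-- 𝔯ᵢ^{(λ)} = ⊕_{μ ≥ λ} (𝔯ᵢ)_μ -/
def rUp (i : Fin 2) (lam : ℤ) : Submodule ℝ M4 :=
  ⨆ (μ : ℤ) (_ : lam ≤ μ), wSpace i μ

/-- a_t = diag(e^t, 1, 1, e^{−t}) -/
def aMat (t : ℝ) : M4 := Matrix.diagonal ![Real.exp t, 1, 1, Real.exp (-t)]

/-- the unipotent elements u^{(i)}_{r,s} -/
def uMat (i : Fin 2) (r s : ℝ) : M4 :=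
  if i = 0 then !![1, r, s, s*r; 0,1,0,s; 0,0,1,r; 0,0,0,1]
  else !![1, r, s, (r^2+s^2)/2; 0,1,0,r; 0,0,1,s; 0,0,0,1]

/-- adjoint action g.X = gXg⁻¹ -/
def Adm (g X : M4) : M4 := g * X * g⁻¹

/-- adjoint action as a linear map -/
def AdLin (g : M4) : M4 →ₗ[ℝ] M4 where
  toFun X := g * X * g⁻¹
  map_add' X Y := by simp [mul_add, add_mul]
  map_smul' c X := by simp [Matrix.mul_smul, Matrix.smul_mul]

/-- the parameter square [−1,1]² -/
def uSq : Set (ℝ × ℝ) := Set.Icc (-1 : ℝ) 1 ×ˢ Set.Icc (-1 : ℝ) 1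

/-- m_U = (1/4)·(Lebesgue measure in the parameters) -/
def mU (S : Set (ℝ × ℝ)) : ENNReal := volume S / 4

/-- modified α-energy 𝒢^{(α)}_{F,δ}(w) -/
def energy (α δ : ℝ) (F : Finset M4) (w : M4) : ℝ :=
  ∑ w' ∈ F.erase w, (max (mnorm (w' - w)) δ) ^ (-α)

/-- φ(α) = (1/36)·min{(8/9)α, 1 − α/9} -/
def phiFn (α : ℝ) : ℝ := (1/36) * min ((8/9)*α) (1 - α/9)

/-- δ-covering number by closed balls for the sup norm -/
def covNum (δ : ℝ) (A : Set M4) : ℕ :=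
  sInf {n : ℕ | ∃ t : Finset M4, t.card = n ∧ A ⊆ ⋃ c ∈ t, {y : M4 | mnorm (y - c) ≤ δ}}

/-- orthonormal basis of a subspace, as a tuple -/
def IsONB {n : Type} [Fintype n] (v : n → M4) (V : Submodule ℝ M4) : Prop :=
  (∀ k, v k ∈ V) ∧ (∀ k l, tinner (v k) (v l) = if k = l then 1 else 0) ∧
    Submodule.span ℝ (Set.range v) = V

/-- Gram matrix of a tuple of vectors -/
def gram {n : Type} [Fintype n] (v : n → M4) : Matrix n n ℝ :=
  Matrix.of fun a b => tinner (v a) (v b)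

/-- weights λ₁,…,λ₅ = −2,…,2 -/
def lamOf : Fin 5 → ℤ := ![-2,-1,0,1,2]

/-- dimension differences 𝖽 = (1,2,3,2,1) -/
def dOf : Fin 5 → ℝ := ![1,2,3,2,1]

/-- Index of the atom of 𝒟^𝐫_ρ containing x, for an adapted orthonormal basis b with weights wt. -/
def atomIdx (b : Fin 9 → M4) (wt : Fin 9 → ℤ) (r : Fin 5 → ℝ) (ρ : ℝ) (x : M4) :
    Fin 5 → Fin 9 → ℤ :=
  fun j k => if lamOf j ≤ wt k then ⌊ tinner x (b k) / ρ ^ (r j) ⌋ else 0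

end

section FiberCounting

variable {X α β γ : Type*} (Ω : Finset X)

/-- The number of points of `Ω` in the fibre of `f` through `x`. -/
noncomputable def fiberCard (f : X → α) (x : X) : ℕ := (Ω.filter fun y => f y = f x).card

/-- The sum of the logarithms of the fibre sizes of `f`; the Shannon entropy of `f` under the
uniform measure on `Ω` is `log |Ω| - fiberLog Ω f / |Ω|`. -/
noncomputable def fiberLog (f : X → α) : ℝ := ∑ x ∈ Ω, Real.log (fiberCard Ω f x)

variable {Ω}

lemma fiberCard_pos (f : X → α) {x : X} (hx : x ∈ Ω) : 0 < fiberCard Ω f x :=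
  Finset.card_pos.2 ⟨x, by simp [hx]⟩

lemma fiberCard_congr (f : X → α) {x y : X} (h : f x = f y) :
    fiberCard Ω f x = fiberCard Ω f y := by
  unfold fiberCard; rw [h]

lemma fiberLog_le_of_determines (f : X → α) (h : X → β)
    (hd : ∀ x ∈ Ω, ∀ y ∈ Ω, f x = f y → h x = h y) : fiberLog Ω f ≤ fiberLog Ω h := by
  refine Finset.sum_le_sum fun x hx => Real.log_le_log
    (by exact_mod_cast fiberCard_pos f hx) ?_
  have : fiberCard Ω f x ≤ fiberCard Ω h x := by
    refine Finset.card_le_card fun y hy => ?_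
    rw [Finset.mem_filter] at hy ⊢
    exact ⟨hy.1, hd y hy.1 x hx hy.2⟩
  exact_mod_cast this

lemma fiberLog_le_of_fiberCard_le (f : X → α) {κ : ℝ}
    (hf : ∀ x ∈ Ω, (fiberCard Ω f x : ℝ) ≤ κ) : fiberLog Ω f ≤ Ω.card * Real.log κ := by
  rw [← nsmul_eq_mul]
  exact Finset.sum_le_card_nsmul _ _ _ fun x hx => Real.log_le_log
    (by exact_mod_cast fiberCard_pos f hx) (hf x hx)

lemma fiberLog_const (a : α) : fiberLog Ω (fun _ => a) = Ω.card * Real.log Ω.card := by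
  simp [fiberLog, fiberCard]

/-- Over a set of points with the same value of `f`, the reciprocals of the fibre sizes sum to at
most one. -/
lemma sum_inv_fiberCard_le (f : X → α) {S : Finset X} (hS : S ⊆ Ω)
    (hf : ∀ x ∈ S, ∀ y ∈ S, f x = f y) : ∑ x ∈ S, ((fiberCard Ω f x : ℝ))⁻¹ ≤ 1 := by
  rcases S.eq_empty_or_nonempty with rfl | ⟨x₀, hx₀⟩
  · simp
  have h : ∀ x ∈ S, ((fiberCard Ω f x : ℝ))⁻¹ = ((fiberCard Ω f x₀ : ℝ))⁻¹ := fun x hx => by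
    rw [fiberCard_congr f (hf x hx x₀ hx₀)]
  rw [Finset.sum_congr rfl h, Finset.sum_const, nsmul_eq_mul, ← div_eq_mul_inv]
  refine div_le_one_of_le₀ ?_ (by positivity)
  have : S.card ≤ fiberCard Ω f x₀ :=
    Finset.card_le_card fun x hx => Finset.mem_filter.2 ⟨hS hx, hf x hx x₀ hx₀⟩
  exact_mod_cast this

lemma sum_log_le_of_sum_le {a : X → ℝ} {κ : ℝ} (hκ : 0 < κ) (ha : ∀ x ∈ Ω, 0 < a x)
    (hs : ∑ x ∈ Ω, a x ≤ κ * Ω.card) : ∑ x ∈ Ω, Real.log (a x) ≤ Ω.card * Real.log κ := by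
  have h : ∀ x ∈ Ω, Real.log (a x) ≤ Real.log κ + (a x / κ - 1) := by
    intro x hx
    have := Real.log_le_sub_one_of_pos (div_pos (ha x hx) hκ)
    rw [Real.log_div (ha x hx).ne' hκ.ne'] at this
    linarith
  refine (Finset.sum_le_sum h).trans ?_
  rw [Finset.sum_add_distrib, Finset.sum_sub_distrib, ← Finset.sum_div]
  simp only [Finset.sum_const, nsmul_eq_mul, mul_one]
  have : (∑ x ∈ Ω, a x) / κ ≤ Ω.card := by rw [div_le_iff₀ hκ]; linarith
  linarith

/-- Strong subadditivity of entropy. -/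
lemma fiberLog_strong_subadditive (f : X → α) (g : X → β) (h : X → γ) :
    fiberLog Ω (fun x => (f x, h x)) + fiberLog Ω (fun x => (g x, h x)) ≤
      fiberLog Ω (fun x => (f x, g x, h x)) + fiberLog Ω h := by
  set fh := fun x => (f x, h x)
  set gh := fun x => (g x, h x)
  set fgh := fun x => (f x, g x, h x)
  have p1 : ∀ x ∈ Ω, (0 : ℝ) < fiberCard Ω fh x := fun x hx => by
    exact_mod_cast fiberCard_pos fh hx
  have p2 : ∀ x ∈ Ω, (0 : ℝ) < fiberCard Ω gh x := fun x hx => by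
    exact_mod_cast fiberCard_pos gh hx
  have p3 : ∀ x ∈ Ω, (0 : ℝ) < fiberCard Ω fgh x := fun x hx => by
    exact_mod_cast fiberCard_pos fgh hx
  have p4 : ∀ x ∈ Ω, (0 : ℝ) < fiberCard Ω h x := fun x hx => by
    exact_mod_cast fiberCard_pos h hx
  have key : ∑ x ∈ Ω, ((fiberCard Ω fh x : ℝ) * fiberCard Ω gh x /
      (fiberCard Ω fgh x * fiberCard Ω h x)) ≤ 1 * Ω.card := by
    have e : ∀ x ∈ Ω, ((fiberCard Ω fh x : ℝ) * fiberCard Ω gh x /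
        (fiberCard Ω fgh x * fiberCard Ω h x)) =
        ∑ y ∈ Ω, ∑ z ∈ Ω, if fh y = fh x ∧ gh z = gh x then
          ((fiberCard Ω fgh x : ℝ))⁻¹ * (fiberCard Ω h x : ℝ)⁻¹ else 0 := by
      intro x _
      have e2 : (∑ y ∈ Ω, ∑ z ∈ Ω, if fh y = fh x ∧ gh z = gh x then
          ((fiberCard Ω fgh x : ℝ))⁻¹ * (fiberCard Ω h x : ℝ)⁻¹ else 0) =
          (fiberCard Ω fh x : ℝ) * ((fiberCard Ω gh x : ℝ) *
          (((fiberCard Ω fgh x : ℝ))⁻¹ * (fiberCard Ω h x : ℝ)⁻¹)) := by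
        have e1 : ∀ y ∈ Ω, (∑ z ∈ Ω, if fh y = fh x ∧ gh z = gh x then
          ((fiberCard Ω fgh x : ℝ))⁻¹ * (fiberCard Ω h x : ℝ)⁻¹ else 0) =
            if fh y = fh x then (fiberCard Ω gh x : ℝ) *
              (((fiberCard Ω fgh x : ℝ))⁻¹ * (fiberCard Ω h x : ℝ)⁻¹) else 0 := by
          intro y _
          split_ifs with hy
          · simp only [hy, true_and]
            rw [← Finset.sum_filter, Finset.sum_const, nsmul_eq_mul]
            unfold fiberCard
            congr!
          · simp [hy]
        rw [Finset.sum_congr rfl e1, ← Finset.sum_filter, Finset.sum_const, nsmul_eq_mul]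
        unfold fiberCard
        congr!
      rw [e2]
      rw [div_eq_mul_inv, mul_inv]; ring
    rw [Finset.sum_congr rfl e, Finset.sum_comm, one_mul]
    have e3 : ∀ y ∈ Ω, (∑ x ∈ Ω, ∑ z ∈ Ω, if fh y = fh x ∧ gh z = gh x then
          ((fiberCard Ω fgh x : ℝ))⁻¹ * (fiberCard Ω h x : ℝ)⁻¹ else 0) ≤ 1 := by
      intro y hy
      rw [Finset.sum_comm]
      have e4 : ∀ z ∈ Ω, (∑ x ∈ Ω, if fh y = fh x ∧ gh z = gh x then
          ((fiberCard Ω fgh x : ℝ))⁻¹ * (fiberCard Ω h x : ℝ)⁻¹ else 0) ≤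
          if h z = h y then (fiberCard Ω h y : ℝ)⁻¹ else 0 := by
        intro z _
        split_ifs with hz
        · have : ∀ x ∈ Ω, (if fh y = fh x ∧ gh z = gh x then
              ((fiberCard Ω fgh x : ℝ))⁻¹ * (fiberCard Ω h x : ℝ)⁻¹ else 0) =
              (if fgh x = (f y, g z, h y) then ((fiberCard Ω fgh x : ℝ))⁻¹ else 0) *
                (fiberCard Ω h y : ℝ)⁻¹ := by
            intro x _
            have hiff : (fh y = fh x ∧ gh z = gh x) ↔ fgh x = (f y, g z, h y) := by
              simp only [fh, gh, fgh, Prod.mk.injEq]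
              constructor
              · rintro ⟨⟨a, b⟩, c, -⟩; exact ⟨a.symm, c.symm, b.symm⟩
              · rintro ⟨a, b, c⟩; exact ⟨⟨a.symm, c.symm⟩, b.symm, hz.trans c.symm⟩
            by_cases hc : fh y = fh x ∧ gh z = gh x
            · rw [if_pos hc, if_pos (hiff.1 hc)]
              have : h x = h y := by
                have := hc.1; simp only [fh, Prod.mk.injEq] at this; exact this.2.symm
              rw [fiberCard_congr h this]
            · rw [if_neg hc, if_neg (fun q => hc (hiff.2 q)), zero_mul]
          rw [Finset.sum_congr rfl this, ← Finset.sum_mul, ← Finset.sum_filter]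
          exact mul_le_of_le_one_left (by positivity) (sum_inv_fiberCard_le fgh
            (Finset.filter_subset _ _) fun a ha b hb =>
              (Finset.mem_filter.1 ha).2.trans (Finset.mem_filter.1 hb).2.symm)
        · refine (Finset.sum_eq_zero fun x _ => if_neg ?_).le
          simp only [fh, gh, Prod.mk.injEq]
          rintro ⟨⟨-, a⟩, -, b⟩
          exact hz (b.trans a.symm)
      refine (Finset.sum_le_sum e4).trans ?_
      rw [← Finset.sum_filter, Finset.sum_const, nsmul_eq_mul]
      exact mul_inv_le_one
    simpa using Finset.sum_le_card_nsmul _ _ _ e3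
  have := sum_log_le_of_sum_le one_pos (fun x hx => div_pos (mul_pos (p1 x hx) (p2 x hx))
    (mul_pos (p3 x hx) (p4 x hx))) key
  rw [Real.log_one, mul_zero] at this
  have e5 : ∀ x ∈ Ω, Real.log ((fiberCard Ω fh x : ℝ) * fiberCard Ω gh x /
      (fiberCard Ω fgh x * fiberCard Ω h x)) = Real.log (fiberCard Ω fh x) +
      Real.log (fiberCard Ω gh x) - (Real.log (fiberCard Ω fgh x) +
      Real.log (fiberCard Ω h x)) := by
    intro x hx
    rw [Real.log_div (mul_pos (p1 x hx) (p2 x hx)).ne' (mul_pos (p3 x hx) (p4 x hx)).ne',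
      Real.log_mul (p1 x hx).ne' (p2 x hx).ne', Real.log_mul (p3 x hx).ne' (p4 x hx).ne']
  rw [Finset.sum_congr rfl e5, Finset.sum_sub_distrib, Finset.sum_add_distrib,
    Finset.sum_add_distrib] at this
  unfold fiberLog
  linarith

lemma fiberLog_subadditive (f : X → α) (g : X → β) :
    fiberLog Ω f + fiberLog Ω g ≤
      fiberLog Ω (fun x => (f x, g x)) + Ω.card * Real.log Ω.card := by
  have h := fiberLog_strong_subadditive (Ω := Ω) f g (fun _ => ())
  rw [fiberLog_const] at h
  have h1 := fiberLog_le_of_determines (Ω := Ω) f (fun x => (f x, ())) (by simp)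
  have h2 := fiberLog_le_of_determines (Ω := Ω) g (fun x => (g x, ())) (by simp)
  have h3 := fiberLog_le_of_determines (Ω := Ω) (fun x => (f x, g x, ()))
    (fun x => (f x, g x)) (by simp)
  linarith

/-- If `h` takes at most `κ` values on each fibre of `f`, then adjoining `h` to `f` raises the
entropy by at most `log κ`. -/
lemma fiberLog_le_fiberLog_prod (f : X → α) (h : X → β) {κ : ℝ} (hκ : 0 < κ)
    (hv : ∀ x ∈ Ω, (((Ω.filter fun y => f y = f x).image h).card : ℝ) ≤ κ) :
    fiberLog Ω f ≤ fiberLog Ω (fun x => (f x, h x)) + Ω.card * Real.log κ := by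
  set fh := fun x => (f x, h x)
  have p1 : ∀ x ∈ Ω, (0 : ℝ) < fiberCard Ω f x := fun x hx => by
    exact_mod_cast fiberCard_pos f hx
  have p2 : ∀ x ∈ Ω, (0 : ℝ) < fiberCard Ω fh x := fun x hx => by
    exact_mod_cast fiberCard_pos fh hx
  have key : ∑ x ∈ Ω, (fiberCard Ω f x : ℝ) / fiberCard Ω fh x ≤ κ * Ω.card := by
    have e : ∀ x ∈ Ω, (fiberCard Ω f x : ℝ) / fiberCard Ω fh x =
        ∑ y ∈ Ω, if f y = f x then (fiberCard Ω fh x : ℝ)⁻¹ else 0 := by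
      intro x _
      rw [← Finset.sum_filter, Finset.sum_const, nsmul_eq_mul, div_eq_mul_inv]; rfl
    rw [Finset.sum_congr rfl e, Finset.sum_comm, mul_comm, ← nsmul_eq_mul]
    refine Finset.sum_le_card_nsmul _ _ _ fun y hy => ?_
    refine le_trans ?_ (hv y hy)
    have e2 : ∀ x ∈ Ω, (if f y = f x then (fiberCard Ω fh x : ℝ)⁻¹ else 0) ≤
        ∑ b ∈ (Ω.filter fun z => f z = f y).image h,
          if fh x = (f y, b) then (fiberCard Ω fh x : ℝ)⁻¹ else 0 := by
      intro x hx
      split_ifs with hc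
      · have hm : h x ∈ (Ω.filter fun z => f z = f y).image h :=
          Finset.mem_image_of_mem _ (by simp [hx, hc])
        refine le_trans ?_ (Finset.single_le_sum (f := fun b => if fh x = (f y, b) then
          (fiberCard Ω fh x : ℝ)⁻¹ else 0) (fun b _ => by positivity) hm)
        simp [fh, hc]
      · exact Finset.sum_nonneg fun b _ => by positivity
    refine (Finset.sum_le_sum e2).trans ?_
    rw [Finset.sum_comm]
    refine (Finset.sum_le_card_nsmul _ _ 1 fun b _ => ?_).trans (by simp)
    rw [← Finset.sum_filter]
    exact sum_inv_fiberCard_le fh (Finset.filter_subset _ _) fun a ha c hc =>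
      (Finset.mem_filter.1 ha).2.trans (Finset.mem_filter.1 hc).2.symm
  have := sum_log_le_of_sum_le hκ (fun x hx => div_pos (p1 x hx) (p2 x hx)) key
  have e5 : ∀ x ∈ Ω, Real.log ((fiberCard Ω f x : ℝ) / fiberCard Ω fh x) =
      Real.log (fiberCard Ω f x) - Real.log (fiberCard Ω fh x) := fun x hx => by
    rw [Real.log_div (p1 x hx).ne' (p2 x hx).ne']
  rw [Finset.sum_congr rfl e5, Finset.sum_sub_distrib] at this
  unfold fiberLog
  linarith

lemma card_mul_log_le_fiberLog (f : X → α) {N : ℝ} (hN : 0 < N)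
    (hf : ((Ω.image f).card : ℝ) ≤ N) :
    Ω.card * Real.log Ω.card ≤ fiberLog Ω f + Ω.card * Real.log N := by
  have h := fiberLog_le_fiberLog_prod (Ω := Ω) (fun _ => ()) f hN (by simpa using fun _ _ => hf)
  rw [fiberLog_const] at h
  have h2 := fiberLog_le_of_determines (Ω := Ω) (fun x => ((), f x)) f (by simp)
  linarith

/-- Four functions with at most `N` values each which together have small fibres, and a function
`h` which is almost determined both by the first two and by the last two. -/
lemma fiberLog_ge_of_four (F : Fin 4 → X → α) (h : X → β) {N κ : ℝ} (hN : 0 < N) (hκ : 0 < κ)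
    (hF : ∀ a, ((Ω.image (F a)).card : ℝ) ≤ N)
    (h1 : ∀ x ∈ Ω, (((Ω.filter fun y => F 0 y = F 0 x ∧ F 1 y = F 1 x).image h).card : ℝ) ≤ κ)
    (h2 : ∀ x ∈ Ω, (((Ω.filter fun y => F 2 y = F 2 x ∧ F 3 y = F 3 x).image h).card : ℝ) ≤ κ)
    (h3 : ∀ x ∈ Ω, ((Ω.filter fun y => ∀ a, F a y = F a x).card : ℝ) ≤ κ) :
    2 * (Ω.card * Real.log Ω.card) ≤ fiberLog Ω h + 4 * (Ω.card * Real.log N) +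
      3 * (Ω.card * Real.log κ) := by
  have a0 := card_mul_log_le_fiberLog (Ω := Ω) (F 0) hN (hF 0)
  have a1 := card_mul_log_le_fiberLog (Ω := Ω) (F 1) hN (hF 1)
  have a2 := card_mul_log_le_fiberLog (Ω := Ω) (F 2) hN (hF 2)
  have a3 := card_mul_log_le_fiberLog (Ω := Ω) (F 3) hN (hF 3)
  have b1 := fiberLog_subadditive (Ω := Ω) (F 0) (F 1)
  have b2 := fiberLog_subadditive (Ω := Ω) (F 2) (F 3)
  have c1 := fiberLog_le_fiberLog_prod (Ω := Ω) (fun x => (F 0 x, F 1 x)) h hκ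
    (by simpa only [Prod.mk.injEq] using h1)
  have c2 := fiberLog_le_fiberLog_prod (Ω := Ω) (fun x => (F 2 x, F 3 x)) h hκ
    (by simpa only [Prod.mk.injEq] using h2)
  have d := fiberLog_strong_subadditive (Ω := Ω) (fun x => (F 0 x, F 1 x))
    (fun x => (F 2 x, F 3 x)) h
  have e := fiberLog_le_of_fiberCard_le (Ω := Ω)
    (fun x => ((F 0 x, F 1 x), (F 2 x, F 3 x), h x)) (κ := κ) (by
      intro x hx
      refine le_trans ?_ (h3 x hx)
      have : fiberCard Ω (fun x => ((F 0 x, F 1 x), (F 2 x, F 3 x), h x)) x ≤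
          (Ω.filter fun y => ∀ a, F a y = F a x).card := by
        refine Finset.card_le_card fun y hy => ?_
        simp only [Finset.mem_filter, Prod.mk.injEq] at hy ⊢
        refine ⟨hy.1, ?_⟩
        simp only [Fin.forall_fin_succ, Fin.succ_zero_eq_one, IsEmpty.forall_iff, and_true]
        exact ⟨hy.2.1.1, hy.2.1.2, hy.2.2.1.1, hy.2.2.1.2⟩
      exact_mod_cast this)
  linarith

/-- Three groups of four functions as in `fiberLog_ge_of_four`, such that the three functions `h`
together have small fibres. -/
lemma card_pow_le_of_groups (F : Fin 3 → Fin 4 → X → α) (h : Fin 3 → X → β) {N κ : ℝ}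
    (hN : 0 < N) (hκ : 0 < κ)
    (hF : ∀ j a, ((Ω.image (F j a)).card : ℝ) ≤ N)
    (h1 : ∀ j, ∀ x ∈ Ω,
      (((Ω.filter fun y => F j 0 y = F j 0 x ∧ F j 1 y = F j 1 x).image (h j)).card : ℝ) ≤ κ)
    (h2 : ∀ j, ∀ x ∈ Ω,
      (((Ω.filter fun y => F j 2 y = F j 2 x ∧ F j 3 y = F j 3 x).image (h j)).card : ℝ) ≤ κ)
    (h3 : ∀ j, ∀ x ∈ Ω, ((Ω.filter fun y => ∀ a, F j a y = F j a x).card : ℝ) ≤ κ)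
    (h4 : ∀ x ∈ Ω, ((Ω.filter fun y => ∀ j, h j y = h j x).card : ℝ) ≤ κ) :
    (Ω.card : ℝ) ^ 4 ≤ N ^ 12 * κ ^ 10 := by
  rcases Ω.eq_empty_or_nonempty with rfl | hne
  · simpa using (by positivity : 0 ≤ N ^ 12 * κ ^ 10)
  have hn : (0 : ℝ) < Ω.card := by exact_mod_cast hne.card_pos
  have g := fun j => fiberLog_ge_of_four (F j) (h j) hN hκ (hF j) (h1 j) (h2 j) (h3 j)
  have b1 := fiberLog_subadditive (Ω := Ω) (h 0) (h 1)
  have b2 := fiberLog_subadditive (Ω := Ω) (fun x => (h 0 x, h 1 x)) (h 2)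
  have e := fiberLog_le_of_fiberCard_le (Ω := Ω)
    (fun x => ((h 0 x, h 1 x), h 2 x)) (κ := κ) (by
      intro x hx
      refine le_trans ?_ (h4 x hx)
      have : fiberCard Ω (fun x => ((h 0 x, h 1 x), h 2 x)) x ≤
          (Ω.filter fun y => ∀ a, h a y = h a x).card := by
        refine Finset.card_le_card fun y hy => ?_
        simp only [Finset.mem_filter, Prod.mk.injEq] at hy ⊢
        refine ⟨hy.1, ?_⟩
        simp only [Fin.forall_fin_succ, Fin.succ_zero_eq_one, IsEmpty.forall_iff, and_true]
        exact ⟨hy.2.1.1, hy.2.1.2, hy.2.2⟩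
      exact_mod_cast this)
  have key : Ω.card * (4 * Real.log Ω.card) ≤ Ω.card * (12 * Real.log N + 10 * Real.log κ) := by
    have g0 := g 0
    have g1 := g 1
    have g2 := g 2
    linarith
  have key2 := le_of_mul_le_mul_left key hn
  rw [← Real.log_le_log_iff (by positivity) (by positivity), Real.log_mul (by positivity)
    (by positivity), Real.log_pow, Real.log_pow, Real.log_pow]
  exact_mod_cast key2

end FiberCounting

section GridCounting

open Polynomial in
/-- A point where a polynomial is much smaller than its leading coefficient is close to the real
part of a complex root. -/
lemma exists_root_near_of_abs_eval_lt (p : ℝ[X]) {τ y : ℝ} (hτ : 0 ≤ τ)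
    (h : |p.eval y| < |p.leadingCoeff| * τ ^ p.natDegree) :
    ∃ z ∈ (p.map (algebraMap ℝ ℂ)).roots.toFinset, |y - z.re| ≤ τ := by
  by_contra! hc
  have hs : (p.map (algebraMap ℝ ℂ)).Splits := IsAlgClosed.splits _
  have hev : ‖(p.map (algebraMap ℝ ℂ)).eval (y : ℂ)‖ = |p.eval y| := by
    rw [← Complex.coe_algebraMap, eval_map_algebraMap, aeval_algebraMap_apply]
    simp
  have hcard : p.natDegree = (p.map (algebraMap ℝ ℂ)).roots.card := by
    rw [← hs.natDegree_eq_card_roots, natDegree_map]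
  rw [hs.eq_prod_roots, eval_mul, eval_C, norm_mul, eval_multiset_prod, Multiset.map_map,
    leadingCoeff_map] at hev
  have hprod : ∀ s : Multiset ℂ, (∀ z ∈ s, τ < |y - z.re|) →
      τ ^ s.card ≤ ‖(s.map (eval (y : ℂ) ∘ fun a => X - C a)).prod‖ := by
    intro s
    induction s using Multiset.induction_on with
    | empty => simp
    | cons a s ih =>
      intro hs
      rw [Multiset.map_cons, Multiset.prod_cons, Multiset.card_cons, norm_mul, pow_succ, mul_comm]
      refine mul_le_mul ?_ (ih fun z hz => hs z (Multiset.mem_cons_of_mem hz)) (by positivity)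
        (norm_nonneg _)
      refine (hs a (Multiset.mem_cons_self _ _)).le.trans ?_
      simpa using Complex.abs_re_le_norm ((y : ℂ) - a)
  have h1 := hprod _ fun z hz => hc z (Multiset.mem_toFinset.2 hz)
  rw [← hcard] at h1
  rw [← hev] at h
  simp only [Complex.coe_algebraMap, Complex.norm_real, Real.norm_eq_abs] at h
  exact absurd (mul_le_mul_of_nonneg_left h1 (abs_nonneg p.leadingCoeff)) (not_le.2 h)

/-- The number of multiples of `1 / K` in an interval of radius `τ`. -/
lemma card_grid_near_le {K : ℕ} {τ : ℝ} (hK : 1 ≤ K * τ) (c : ℝ) (S : Finset ℤ) :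
    ((S.filter fun k : ℤ => |(k : ℝ) / K - c| ≤ τ).card : ℝ) ≤ 3 * (K * τ) := by
  have hK0 : (0 : ℝ) < K := by
    rcases Nat.eq_zero_or_pos K with rfl | h
    · norm_num at hK
    · exact_mod_cast h
  have hsub : (S.filter fun k : ℤ => |(k : ℝ) / K - c| ≤ τ) ⊆
      Finset.Icc ⌈K * (c - τ)⌉ ⌊K * (c + τ)⌋ := by
    intro k hk
    have h := abs_le.1 (Finset.mem_filter.1 hk).2
    have e : (k : ℝ) = K * (k / K) := by field_simp
    rw [Finset.mem_Icc, Int.ceil_le, Int.le_floor, e]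
    exact ⟨mul_le_mul_of_nonneg_left (by linarith) hK0.le,
      mul_le_mul_of_nonneg_left (by linarith) hK0.le⟩
  have h1 : ((S.filter fun k : ℤ => |(k : ℝ) / K - c| ≤ τ).card : ℝ) ≤
      ((⌊K * (c + τ)⌋ + 1 - ⌈K * (c - τ)⌉).toNat : ℝ) := by
    exact_mod_cast (Finset.card_le_card hsub).trans (Int.card_Icc _ _).le
  refine h1.trans ?_
  have h2 : ((⌊K * (c + τ)⌋ + 1 - ⌈K * (c - τ)⌉ : ℤ) : ℝ) ≤ 3 * (K * τ) := by
    push_cast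
    have := Int.floor_le (K * (c + τ))
    have := Int.le_ceil (K * (c - τ))
    nlinarith
  rcases le_total 0 (⌊K * (c + τ)⌋ + 1 - ⌈K * (c - τ)⌉) with h0 | h0
  · have : (((⌊K * (c + τ)⌋ + 1 - ⌈K * (c - τ)⌉).toNat : ℤ) : ℝ) =
        ((⌊K * (c + τ)⌋ + 1 - ⌈K * (c - τ)⌉ : ℤ) : ℝ) := by rw [Int.toNat_of_nonneg h0]
    rw [← this] at h2
    exact_mod_cast h2
  · rw [Int.toNat_of_nonpos h0]
    push_cast
    linarith

lemma card_Icc_grid {K : ℕ} : (Finset.Icc (-(K : ℤ)) K).card = 2 * K + 1 := by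
  rw [Int.card_Icc]; omega

open Polynomial in
lemma card_grid_eval_lt_le (p : ℝ[X]) {K : ℕ} {τ : ℝ} (hτ : 0 ≤ τ) (hK : 1 ≤ K * τ)
    (S : Finset ℤ) :
    ((S.filter fun k : ℤ => |p.eval ((k : ℝ) / K)| < |p.leadingCoeff| * τ ^ p.natDegree).card : ℝ)
      ≤ p.natDegree * (3 * (K * τ)) := by
  set R := (p.map (algebraMap ℝ ℂ)).roots.toFinset
  have hR : R.card ≤ p.natDegree :=
    (Multiset.toFinset_card_le _).trans ((card_roots' _).trans natDegree_map_le)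
  have hsub : (S.filter fun k : ℤ =>
      |p.eval ((k : ℝ) / K)| < |p.leadingCoeff| * τ ^ p.natDegree) ⊆
      R.biUnion fun z => S.filter fun k : ℤ => |(k : ℝ) / K - z.re| ≤ τ := by
    intro k hk
    rw [Finset.mem_filter] at hk
    obtain ⟨z, hz, h⟩ := exists_root_near_of_abs_eval_lt p hτ hk.2
    exact Finset.mem_biUnion.2 ⟨z, hz, Finset.mem_filter.2 ⟨hk.1, h⟩⟩
  calc _ ≤ ((R.biUnion fun z => S.filter fun k : ℤ => |(k : ℝ) / K - z.re| ≤ τ).card : ℝ) := by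
        exact_mod_cast Finset.card_le_card hsub
    _ ≤ ∑ z ∈ R, ((S.filter fun k : ℤ => |(k : ℝ) / K - z.re| ≤ τ).card : ℝ) := by
        exact_mod_cast Finset.card_biUnion_le
    _ ≤ R.card * (3 * (K * τ)) := by
        rw [← nsmul_eq_mul]
        exact Finset.sum_le_card_nsmul _ _ _ fun z _ => card_grid_near_le hK _ _
    _ ≤ _ := by
        have : (R.card : ℝ) ≤ p.natDegree := by exact_mod_cast hR
        exact mul_le_mul_of_nonneg_right this (by positivity)

/-- A nonzero polynomial is small at few points of a fine grid. -/
lemma exists_card_grid_small_le_fin (n : ℕ) (P : MvPolynomial (Fin n) ℝ) (hP : P ≠ 0) :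
    ∃ (C : ℝ) (m : ℕ), 0 < C ∧ ∀ (K : ℕ) (τ : ℝ), 0 < τ → τ ≤ 1 → 1 ≤ K * τ →
      (((Fintype.piFinset fun _ : Fin n => Finset.Icc (-(K : ℤ)) K).filter fun g =>
        |MvPolynomial.eval (fun a => (g a : ℝ) / K) P| ≤ τ ^ m).card : ℝ) ≤ C * τ * K ^ n := by
  induction n with
  | zero =>
    obtain ⟨a, rfl⟩ := MvPolynomial.C_surjective (Fin 0) P
    have ha : 0 < |a| := abs_pos.2 fun h => hP (by rw [h, map_zero])
    refine ⟨|a|⁻¹, 1, by positivity, fun K τ hτ _ _ => ?_⟩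
    simp only [MvPolynomial.eval_C, pow_one, pow_zero, mul_one]
    by_cases h : |a| ≤ τ
    · refine (Nat.cast_le.2 (Finset.card_filter_le _ _)).trans ?_
      rw [Fintype.card_piFinset]
      simp only [Finset.univ_eq_empty, Finset.prod_empty, Nat.cast_one]
      rw [inv_mul_eq_div, le_div_iff₀ ha]; linarith
    · simp only [h, Finset.filter_false, Finset.card_empty, Nat.cast_zero]; positivity
  | succ n ih =>
    set Q := MvPolynomial.finSuccEquiv ℝ n P with hQ
    have hQ0 : Q ≠ 0 := by simpa [hQ] using hP
    obtain ⟨C, m, hC, h⟩ := ih Q.leadingCoeff (Polynomial.leadingCoeff_ne_zero.2 hQ0)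
    set d := Q.natDegree with hd
    refine ⟨3 * C + 3 ^ n * (3 * d), m + d, by positivity, fun K τ hτ hτ1 hK => ?_⟩
    have hK1 : (1 : ℝ) ≤ K := by
      have : (0 : ℝ) ≤ K := by positivity
      nlinarith
    set G : (n : ℕ) → Finset (Fin n → ℤ) :=
      fun n => Fintype.piFinset fun _ => Finset.Icc (-(K : ℤ)) K with hG
    set bad := (G n).filter fun g =>
      |MvPolynomial.eval (fun a => (g a : ℝ) / K) Q.leadingCoeff| ≤ τ ^ m with hbad
    set S := (G (n + 1)).filter fun g =>
      |MvPolynomial.eval (fun a => (g a : ℝ) / K) P| ≤ τ ^ (m + d) with hS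
    have hmaps : ∀ g ∈ S, Fin.tail g ∈ G n := by
      intro g hg
      have := (Finset.mem_filter.1 hg).1
      simp only [hG, Fintype.mem_piFinset] at this ⊢
      exact fun a => this a.succ
    have hfib : ∀ b ∈ G n, ((S.filter fun g => Fin.tail g = b).card : ℝ) ≤
        (if b ∈ bad then 3 * (K : ℝ) else 0) + d * (3 * (K * τ)) := by
      intro b hb
      have hinj : Set.InjOn (fun g : Fin (n + 1) → ℤ => g 0)
          (S.filter fun g => Fin.tail g = b : Finset _) := by
        intro g hg g' hg' h0
        have e := (Finset.mem_filter.1 hg).2.trans (Finset.mem_filter.1 hg').2.symm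
        rw [← Fin.cons_self_tail g, ← Fin.cons_self_tail g', e]
        exact congrArg (fun t => Fin.cons t (Fin.tail g')) h0
      split_ifs with hbb
      · have : ((S.filter fun g => Fin.tail g = b).card) ≤ (Finset.Icc (-(K : ℤ)) K).card := by
          refine Finset.card_le_card_of_injOn _ (fun g hg => ?_) hinj
          have := (Finset.mem_filter.1 (Finset.mem_filter.1 hg).1).1
          simp only [hG, Fintype.mem_piFinset] at this
          exact this 0
        rw [card_Icc_grid] at this
        have : ((S.filter fun g => Fin.tail g = b).card : ℝ) ≤ 2 * K + 1 := by exact_mod_cast this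
        have : 0 ≤ d * (3 * (K * τ)) := by positivity
        linarith
      · set p := Q.map (MvPolynomial.eval fun a => (b a : ℝ) / K) with hp
        have hlead : τ ^ m < |MvPolynomial.eval (fun a => (b a : ℝ) / K) Q.leadingCoeff| := by
          by_contra hc
          exact hbb (Finset.mem_filter.2 ⟨hb, not_lt.1 hc⟩)
        have hne : MvPolynomial.eval (fun a => (b a : ℝ) / K) Q.leadingCoeff ≠ 0 := by
          intro h0
          rw [h0, abs_zero] at hlead
          exact absurd hlead (not_lt.2 (by positivity))
        have hpd : p.natDegree = d := Polynomial.natDegree_map_of_leadingCoeff_ne_zero _ hne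
        have hpl : p.leadingCoeff =
            MvPolynomial.eval (fun a => (b a : ℝ) / K) Q.leadingCoeff :=
          Polynomial.leadingCoeff_map_of_leadingCoeff_ne_zero _ hne
        have := card_grid_eval_lt_le p hτ.le hK (Finset.Icc (-(K : ℤ)) K)
        rw [hpd] at this
        rw [zero_add]
        refine le_trans ?_ this
        have : (S.filter fun g => Fin.tail g = b).card ≤ ((Finset.Icc (-(K : ℤ)) K).filter
            fun k : ℤ => |p.eval ((k : ℝ) / K)| < |p.leadingCoeff| * τ ^ d).card := by
          refine Finset.card_le_card_of_injOn _ (fun g hg => ?_) hinj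
          obtain ⟨hgS, hgb⟩ := Finset.mem_filter.1 hg
          obtain ⟨hgG, hgs⟩ := Finset.mem_filter.1 hgS
          simp only [hG, Fintype.mem_piFinset] at hgG
          refine Finset.mem_filter.2 ⟨hgG 0, ?_⟩
          have e : (fun a => (g a : ℝ) / K) =
              Fin.cons ((g 0 : ℝ) / K) fun a => (b a : ℝ) / K := by
            funext a
            refine Fin.cases ?_ (fun a => ?_) a
            · simp
            · simp [← hgb, Fin.tail]
          rw [e, MvPolynomial.eval_eq_eval_mv_eval', ← hQ, ← hp, pow_add] at hgs
          refine hgs.trans_lt ?_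
          rw [hpl]
          exact mul_lt_mul_of_pos_right hlead (by positivity)
        exact_mod_cast this
    have hcardG : ((G n).card : ℝ) ≤ 3 ^ n * K ^ n := by
      have : (G n).card = (2 * K + 1) ^ n := by
        simp only [hG, Fintype.card_piFinset_const, card_Icc_grid]
      rw [this, ← mul_pow]
      push_cast
      gcongr
      linarith
    calc (S.card : ℝ) = ∑ b ∈ G n, ((S.filter fun g => Fin.tail g = b).card : ℝ) := by
          exact_mod_cast Finset.card_eq_sum_card_fiberwise hmaps
      _ ≤ ∑ b ∈ G n, ((if b ∈ bad then 3 * (K : ℝ) else 0) + d * (3 * (K * τ))) :=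
          Finset.sum_le_sum hfib
      _ = bad.card * (3 * (K : ℝ)) + (G n).card * (d * (3 * (K * τ))) := by
          rw [Finset.sum_add_distrib, ← Finset.sum_filter, Finset.sum_const, Finset.sum_const,
            nsmul_eq_mul, nsmul_eq_mul, Finset.filter_mem_eq_inter,
            Finset.inter_eq_right.2 (Finset.filter_subset _ _)]
      _ ≤ (C * τ * K ^ n) * (3 * (K : ℝ)) + (3 ^ n * K ^ n) * (d * (3 * (K * τ))) := by
          have := h K τ hτ hτ1 hK
          gcongr
      _ = _ := by ring

lemma exists_card_grid_small_le {σ : Type*} [Fintype σ] (P : MvPolynomial σ ℝ) (hP : P ≠ 0) :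
    ∃ (C : ℝ) (m : ℕ), 0 < C ∧ ∀ (K : ℕ) (τ : ℝ), 0 < τ → τ ≤ 1 → 1 ≤ K * τ →
      (((Fintype.piFinset fun _ : σ => Finset.Icc (-(K : ℤ)) K).filter fun g =>
        |MvPolynomial.eval (fun a => (g a : ℝ) / K) P| ≤ τ ^ m).card : ℝ) ≤
          C * τ * K ^ Fintype.card σ := by
  set e := Fintype.equivFin σ
  obtain ⟨C, m, hC, h⟩ := exists_card_grid_small_le_fin _ (MvPolynomial.rename e P)
    (fun h0 => hP (MvPolynomial.rename_injective e e.injective (by rw [h0, map_zero])))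
  refine ⟨C, m, hC, fun K τ hτ hτ1 hK => le_trans ?_ (h K τ hτ hτ1 hK)⟩
  norm_cast
  refine Finset.card_le_card_of_injOn (fun g => g ∘ e.symm) (fun g hg => ?_)
    (e.symm.surjective.injective_comp_right.injOn)
  obtain ⟨h1, h2⟩ := Finset.mem_filter.1 hg
  rw [Fintype.mem_piFinset] at h1
  refine Finset.mem_filter.2 ⟨Fintype.mem_piFinset.2 fun a => h1 _, ?_⟩
  rw [MvPolynomial.eval_rename]
  simpa [Function.comp_def] using h2

/-- Polynomials are bounded and Lipschitz on bounded boxes. -/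
lemma exists_bound_and_lipschitz {σ : Type*} (P : MvPolynomial σ ℝ) (R : ℝ) (hR : 0 ≤ R) :
    ∃ L : ℝ, 0 ≤ L ∧ (∀ x : σ → ℝ, (∀ a, |x a| ≤ R) → |MvPolynomial.eval x P| ≤ L) ∧
      ∀ (x y : σ → ℝ) (ρ : ℝ), (∀ a, |x a| ≤ R) → (∀ a, |y a| ≤ R) → (∀ a, |x a - y a| ≤ ρ) →
        0 ≤ ρ → |MvPolynomial.eval x P - MvPolynomial.eval y P| ≤ L * ρ := by
  induction P using MvPolynomial.induction_on with
  | C a =>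
    refine ⟨|a|, abs_nonneg a, fun x _ => by simp, fun x y ρ _ _ _ hρ => ?_⟩
    simp only [MvPolynomial.eval_C, sub_self, abs_zero]
    positivity
  | add p q hp hq =>
    obtain ⟨L, hL, h1, h2⟩ := hp
    obtain ⟨L', hL', h1', h2'⟩ := hq
    refine ⟨L + L', by positivity, fun x hx => ?_, fun x y ρ hx hy hxy hρ => ?_⟩
    · rw [map_add]
      exact (abs_add_le _ _).trans (add_le_add (h1 x hx) (h1' x hx))
    · rw [map_add, map_add, add_sub_add_comm, add_mul]
      exact (abs_add_le _ _).trans (add_le_add (h2 x y ρ hx hy hxy hρ) (h2' x y ρ hx hy hxy hρ))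
  | mul_X p a hp =>
    obtain ⟨L, hL, h1, h2⟩ := hp
    refine ⟨L * R + L, by positivity, fun x hx => ?_, fun x y ρ hx hy hxy hρ => ?_⟩
    · rw [map_mul, MvPolynomial.eval_X, abs_mul]
      have := mul_le_mul (h1 x hx) (hx a) (abs_nonneg _) hL
      linarith
    · rw [map_mul, map_mul, MvPolynomial.eval_X, MvPolynomial.eval_X]
      have e : MvPolynomial.eval x p * x a - MvPolynomial.eval y p * y a =
        (MvPolynomial.eval x p - MvPolynomial.eval y p) * x a +
          MvPolynomial.eval y p * (x a - y a) := by ring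
      rw [e]
      refine (abs_add_le _ _).trans ?_
      rw [abs_mul, abs_mul]
      have a1 := mul_le_mul (h2 x y ρ hx hy hxy hρ) (hx a) (abs_nonneg _) (by positivity)
      have a2 := mul_le_mul (h1 y hy) (hxy a) (abs_nonneg _) hL
      linarith

end GridCounting

section Jets

/-- The first row of `uMat i p.1 p.2`, a null vector, together with its two partial derivatives. -/
noncomputable def nullFrame (i : Fin 2) (p : ℝ × ℝ) : Fin 3 → Fin 4 → ℝ :=
  if i = 0 then ![![1, p.1, p.2, p.2 * p.1], ![0, 1, 0, p.2], ![0, 0, 1, p.1]]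
  else ![![1, p.1, p.2, (p.1 ^ 2 + p.2 ^ 2) / 2], ![0, 1, 0, p.1], ![0, 0, 1, p.2]]

/-- The bilinear form on `ℝ⁴` attached to an element of `rSpace i`, evaluated at `(a, b)`, as a
linear functional in the coordinates `rCoord`. -/
noncomputable def bilFunctional (i : Fin 2) (a b : Fin 4 → ℝ) : Fin 9 → ℝ :=
  if i = 0 then ![a 0 * b 0, a 0 * b 1 + a 1 * b 0, a 0 * b 2 + a 2 * b 0,
    a 0 * b 3 + a 3 * b 0 + (a 1 * b 2 + a 2 * b 1), a 1 * b 1, a 1 * b 3 + a 3 * b 1,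
    a 2 * b 2, a 2 * b 3 + a 3 * b 2, a 3 * b 3]
  else ![a 0 * b 0, a 0 * b 1 + a 1 * b 0, a 0 * b 2 + a 2 * b 0, a 1 * b 2 + a 2 * b 1,
    a 1 * b 1 + (a 0 * b 3 + a 3 * b 0) / 2, a 1 * b 3 + a 3 * b 1,
    a 2 * b 2 + (a 0 * b 3 + a 3 * b 0) / 2, a 2 * b 3 + a 3 * b 2, a 3 * b 3]

/-- Coordinates on `rSpace i`. -/
def rCoord (i : Fin 2) (X : M4) : Fin 9 → ℝ :=
  if i = 0 then ![-X 0 3, X 0 2, X 0 1, -X 0 0, X 1 2, -X 1 0, X 2 1, -X 2 0, -X 3 0]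
  else ![-X 0 3, X 0 1, X 0 2, X 1 2, X 1 1, -X 1 0, X 2 2, -X 2 0, -X 3 0]

/-- The functionals giving the components of positive weight of the translate by
`uMat i p.1 p.2`. -/
noncomputable def jet (i : Fin 2) (p : ℝ × ℝ) (j : Fin 3) : Fin 9 → ℝ :=
  bilFunctional i (nullFrame i p 0) (nullFrame i p j)

/-- Up to sign, the pairing of the null vectors of two points. -/
noncomputable def nullPairing (i : Fin 2) (p q : ℝ × ℝ) : ℝ :=
  if i = 0 then (p.1 - q.1) * (p.2 - q.2) else ((p.1 - q.1) ^ 2 + (p.2 - q.2) ^ 2) / 2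

noncomputable def tangentFunctional (i : Fin 2) (p q t : ℝ × ℝ) : Fin 9 → ℝ :=
  nullPairing i p t • bilFunctional i (nullFrame i p 0) (nullFrame i q 0) -
    nullPairing i p q • bilFunctional i (nullFrame i p 0) (nullFrame i t 0)

/-- A functional in the span of the jets at `p`, and also in the span of those at `q` and `t`. -/
noncomputable def commonFunctional (i : Fin 2) (p q t : ℝ × ℝ) : Fin 9 → ℝ :=
  nullPairing i q t • tangentFunctional i p q t

lemma tangentFunctional_eq (i : Fin 2) (p q t : ℝ × ℝ) :
    tangentFunctional i p q t =
      (nullPairing i p t - nullPairing i p q) • jet i p 0 +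
      (nullPairing i p t * (q.1 - p.1) - nullPairing i p q * (t.1 - p.1)) • jet i p 1 +
      (nullPairing i p t * (q.2 - p.2) - nullPairing i p q * (t.2 - p.2)) • jet i p 2 := by
  funext m
  fin_cases i <;> fin_cases m <;>
    simp [tangentFunctional, jet, bilFunctional, nullFrame, nullPairing] <;> ring

lemma commonFunctional_eq (i : Fin 2) (p q t : ℝ × ℝ) :
    commonFunctional i p q t = nullPairing i p t • tangentFunctional i q p t -
      nullPairing i p q • tangentFunctional i t p q := by
  funext m
  fin_cases i <;> fin_cases m <;>
    simp [commonFunctional, tangentFunctional, bilFunctional, nullFrame, nullPairing] <;> ring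

/-- The parameter point lies in the square `[-1, 1]²`. -/
def InBox (p : ℝ × ℝ) : Prop := |p.1| ≤ 1 ∧ |p.2| ≤ 1

lemma abs_sub_le_two {a b : ℝ} (ha : |a| ≤ 1) (hb : |b| ≤ 1) : |a - b| ≤ 2 :=
  (abs_sub _ _).trans (by linarith)

lemma abs_nullPairing_le (i : Fin 2) {p q : ℝ × ℝ} (hp : InBox p) (hq : InBox q) :
    |nullPairing i p q| ≤ 4 := by
  have h1 := abs_sub_le_two hp.1 hq.1
  have h2 := abs_sub_le_two hp.2 hq.2
  unfold nullPairing
  split_ifs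
  · rw [abs_mul]
    have := mul_le_mul h1 h2 (abs_nonneg _) (by norm_num)
    linarith
  · rw [abs_of_nonneg (by positivity)]
    have := sq_le_sq' (abs_le.1 h1).1 (abs_le.1 h1).2
    have := sq_le_sq' (abs_le.1 h2).1 (abs_le.1 h2).2
    linarith

lemma abs_mul_sub_mul_le {a b c d : ℝ} (ha : |a| ≤ 4) (hb : |b| ≤ 4) (hc : |c| ≤ 2)
    (hd : |d| ≤ 2) : |a * c - b * d| ≤ 16 := by
  refine (abs_sub _ _).trans ?_
  rw [abs_mul, abs_mul]
  have := mul_le_mul ha hc (abs_nonneg _) (by norm_num)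
  have := mul_le_mul hb hd (abs_nonneg _) (by norm_num)
  linarith

lemma abs_tangentFunctional_dotProduct_le (i : Fin 2) {p q t : ℝ × ℝ} (hp : InBox p)
    (hq : InBox q) (ht : InBox t) {x : Fin 9 → ℝ} {δ : ℝ} (h : ∀ j, |jet i p j ⬝ᵥ x| ≤ δ) :
    |tangentFunctional i p q t ⬝ᵥ x| ≤ 40 * δ := by
  have a1 := abs_nullPairing_le i hp hq
  have a2 := abs_nullPairing_le i hp ht
  have b0 : |nullPairing i p t - nullPairing i p q| ≤ 8 := (abs_sub _ _).trans (by linarith)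
  have b1 := abs_mul_sub_mul_le a2 a1 (abs_sub_le_two hq.1 hp.1) (abs_sub_le_two ht.1 hp.1)
  have b2 := abs_mul_sub_mul_le a2 a1 (abs_sub_le_two hq.2 hp.2) (abs_sub_le_two ht.2 hp.2)
  rw [tangentFunctional_eq, add_dotProduct, add_dotProduct, smul_dotProduct, smul_dotProduct,
    smul_dotProduct]
  refine (abs_add_three _ _ _).trans ?_
  simp only [smul_eq_mul, abs_mul]
  have c0 := mul_le_mul b0 (h 0) (abs_nonneg _) (by norm_num)
  have c1 := mul_le_mul b1 (h 1) (abs_nonneg _) (by norm_num)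
  have c2 := mul_le_mul b2 (h 2) (abs_nonneg _) (by norm_num)
  linarith

lemma abs_commonFunctional_dotProduct_le (i : Fin 2) {p q t : ℝ × ℝ} (hp : InBox p)
    (hq : InBox q) (ht : InBox t) {x : Fin 9 → ℝ} {δ : ℝ} (h : ∀ j, |jet i p j ⬝ᵥ x| ≤ δ) :
    |commonFunctional i p q t ⬝ᵥ x| ≤ 320 * δ := by
  have h1 := mul_le_mul (abs_nullPairing_le i hq ht)
    (abs_tangentFunctional_dotProduct_le i hp hq ht h) (abs_nonneg _) (by norm_num)
  have hδ : 0 ≤ δ := (abs_nonneg _).trans (h 0)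
  rw [commonFunctional, smul_dotProduct, smul_eq_mul, abs_mul]
  linarith

lemma abs_commonFunctional_dotProduct_le' (i : Fin 2) {p q t : ℝ × ℝ} (hp : InBox p)
    (hq : InBox q) (ht : InBox t) {x : Fin 9 → ℝ} {δ : ℝ} (h : ∀ j, |jet i q j ⬝ᵥ x| ≤ δ)
    (h' : ∀ j, |jet i t j ⬝ᵥ x| ≤ δ) : |commonFunctional i p q t ⬝ᵥ x| ≤ 320 * δ := by
  have h1 := mul_le_mul (abs_nullPairing_le i hp ht)
    (abs_tangentFunctional_dotProduct_le i hq hp ht h) (abs_nonneg _) (by norm_num)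
  have h2 := mul_le_mul (abs_nullPairing_le i hp hq)
    (abs_tangentFunctional_dotProduct_le i ht hp hq h') (abs_nonneg _) (by norm_num)
  rw [commonFunctional_eq, sub_dotProduct, smul_dotProduct, smul_dotProduct]
  refine (abs_sub _ _).trans ?_
  simp only [smul_eq_mul, abs_mul]
  linarith

/-- Nine of the twelve jet functionals at four points. -/
noncomputable def jetMatrix (i : Fin 2) (p : Fin 4 → ℝ × ℝ) : Matrix (Fin 9) (Fin 9) ℝ :=
  Matrix.of ![jet i (p 0) 0, jet i (p 0) 1, jet i (p 0) 2, jet i (p 1) 0, jet i (p 1) 1,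
    jet i (p 1) 2, jet i (p 2) 0, jet i (p 2) 1, jet i (p 3) 0]

/-- Three functionals in the intersection of the span of the jets at `p 0`, `p 1` with the span of
the jets at `p 2`, `p 3`. -/
noncomputable def commonTriple (i : Fin 2) (p : Fin 4 → ℝ × ℝ) : Fin 3 → Fin 9 → ℝ :=
  ![commonFunctional i (p 0) (p 2) (p 3), commonFunctional i (p 1) (p 2) (p 3),
    commonFunctional i (p 2) (p 0) (p 1)]

/-- The common functionals of three groups of four points. -/
noncomputable def commonMatrix (i : Fin 2) (p : Fin 3 × Fin 4 → ℝ × ℝ) :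
    Matrix (Fin 9) (Fin 9) ℝ :=
  Matrix.of ![commonTriple i (fun b => p (0, b)) 0, commonTriple i (fun b => p (0, b)) 1,
    commonTriple i (fun b => p (0, b)) 2,
    commonTriple i (fun b => p (1, b)) 0, commonTriple i (fun b => p (1, b)) 1,
    commonTriple i (fun b => p (1, b)) 2,
    commonTriple i (fun b => p (2, b)) 0, commonTriple i (fun b => p (2, b)) 1,
    commonTriple i (fun b => p (2, b)) 2]

lemma abs_commonTriple_dotProduct_le_left (i : Fin 2) {p : Fin 4 → ℝ × ℝ} (hp : ∀ a, InBox (p a))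
    {x : Fin 9 → ℝ} {δ : ℝ} (h0 : ∀ j, |jet i (p 0) j ⬝ᵥ x| ≤ δ)
    (h1 : ∀ j, |jet i (p 1) j ⬝ᵥ x| ≤ δ) (m : Fin 3) :
    |commonTriple i p m ⬝ᵥ x| ≤ 320 * δ := by
  fin_cases m
  · exact abs_commonFunctional_dotProduct_le i (hp 0) (hp 2) (hp 3) h0
  · exact abs_commonFunctional_dotProduct_le i (hp 1) (hp 2) (hp 3) h1
  · exact abs_commonFunctional_dotProduct_le' i (hp 2) (hp 0) (hp 1) h0 h1

lemma abs_commonTriple_dotProduct_le_right (i : Fin 2) {p : Fin 4 → ℝ × ℝ}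
    (hp : ∀ a, InBox (p a)) {x : Fin 9 → ℝ} {δ : ℝ} (h2 : ∀ j, |jet i (p 2) j ⬝ᵥ x| ≤ δ)
    (h3 : ∀ j, |jet i (p 3) j ⬝ᵥ x| ≤ δ) (m : Fin 3) :
    |commonTriple i p m ⬝ᵥ x| ≤ 320 * δ := by
  fin_cases m
  · exact abs_commonFunctional_dotProduct_le' i (hp 0) (hp 2) (hp 3) h2 h3
  · exact abs_commonFunctional_dotProduct_le' i (hp 1) (hp 2) (hp 3) h2 h3
  · exact abs_commonFunctional_dotProduct_le i (hp 2) (hp 0) (hp 1) h2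

lemma exists_jetMatrix_det_ne_zero (i : Fin 2) :
    ∃ p : Fin 4 → ℝ × ℝ, (jetMatrix i p).det ≠ 0 := by
  refine ⟨if i = 0 then ![(0, -2), (1, 0), (0, -1), (-2, 2)]
    else ![(0, 0), (1, 0), (0, -1), (-1, 0)], fun h => ?_⟩
  obtain ⟨v, hv, hM⟩ := Matrix.exists_mulVec_eq_zero_iff.2 h
  refine hv ?_
  have e := fun a => congrFun hM a
  simp only [Fin.forall_fin_succ, jetMatrix, Matrix.mulVec, dotProduct, Fin.sum_univ_succ] at e
  fin_cases i
  all_goals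
    simp [jet, bilFunctional, nullFrame] at e
    obtain ⟨e0, e1, e2, e3, e4, e5, e6, e7, e8⟩ := e
    funext m
    fin_cases m <;> simp <;> linarith

lemma exists_commonMatrix_det_ne_zero (i : Fin 2) :
    ∃ p : Fin 3 × Fin 4 → ℝ × ℝ, (commonMatrix i p).det ≠ 0 := by
  refine ⟨fun a => if i = 0 then ![![(2, -1), (1, 0), (-1, 2), (0, -1)],
      ![(0, 2), (2, -2), (-1, 0), (0, 2)], ![(0, -2), (2, 0), (-1, -1), (1, -2)]] a.1 a.2
    else ![![(0, 0), (-1, 1), (-1, -1), (1, -1)], ![(0, 1), (0, -1), (0, 0), (0, 1)],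
      ![(1, 0), (0, -1), (1, -1), (1, 1)]] a.1 a.2, fun h => ?_⟩
  obtain ⟨v, hv, hM⟩ := Matrix.exists_mulVec_eq_zero_iff.2 h
  refine hv ?_
  have e := fun a => congrFun hM a
  simp only [Fin.forall_fin_succ, commonMatrix, Matrix.mulVec, dotProduct, Fin.sum_univ_succ] at e
  fin_cases i
  all_goals
    simp [commonTriple, commonFunctional, tangentFunctional, bilFunctional, nullFrame,
      nullPairing] at e
    norm_num at e
    obtain ⟨e0, e1, e2, e3, e4, e5, e6, e7, e8⟩ := e
    funext m
    fin_cases m <;> simp <;> linarith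

end Jets

section CoreInequality

variable {ι : Type*}

/-- The real coordinates of a family of points of the plane. -/
def coordVal (p : ι → ℝ × ℝ) (a : ι × Fin 2) : ℝ := ![(p a.1).1, (p a.1).2] a.2

/-- The algebra of polynomial functions of a family of points of the plane. -/
noncomputable def polyFun (ι : Type*) : Subalgebra ℝ ((ι → ℝ × ℝ) → ℝ) :=
  (MvPolynomial.aeval fun (a : ι × Fin 2) (p : ι → ℝ × ℝ) => coordVal p a).range

lemma aeval_coordVal_apply (P : MvPolynomial (ι × Fin 2) ℝ) (p : ι → ℝ × ℝ) :
    MvPolynomial.aeval (fun (a : ι × Fin 2) (p : ι → ℝ × ℝ) => coordVal p a) P p =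
      MvPolynomial.eval (coordVal p) P := by
  have := MvPolynomial.comp_aeval_apply (fun (a : ι × Fin 2) (p : ι → ℝ × ℝ) => coordVal p a)
    (Pi.evalAlgHom ℝ (fun _ : ι → ℝ × ℝ => ℝ) p) P
  simpa [MvPolynomial.aeval_eq_eval] using this

lemma exists_eval_eq_of_mem_polyFun {f : (ι → ℝ × ℝ) → ℝ} (hf : f ∈ polyFun ι) :
    ∃ P : MvPolynomial (ι × Fin 2) ℝ, ∀ p, f p = MvPolynomial.eval (coordVal p) P := by
  obtain ⟨P, rfl⟩ := hf
  exact ⟨P, fun p => aeval_coordVal_apply P p⟩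

lemma fst_mem_polyFun (x : ι) : (fun p : ι → ℝ × ℝ => (p x).1) ∈ polyFun ι :=
  ⟨MvPolynomial.X (x, 0), by funext p; simp [coordVal]⟩

lemma snd_mem_polyFun (x : ι) : (fun p : ι → ℝ × ℝ => (p x).2) ∈ polyFun ι :=
  ⟨MvPolynomial.X (x, 1), by funext p; simp [coordVal]⟩

lemma const_mem_polyFun (c : ℝ) : (fun _ : ι → ℝ × ℝ => c) ∈ polyFun ι :=
  (polyFun ι).algebraMap_mem c

lemma add_mem_polyFun {f g : (ι → ℝ × ℝ) → ℝ} (hf : f ∈ polyFun ι) (hg : g ∈ polyFun ι) :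
    (fun p => f p + g p) ∈ polyFun ι := (polyFun ι).add_mem hf hg

lemma sub_mem_polyFun {f g : (ι → ℝ × ℝ) → ℝ} (hf : f ∈ polyFun ι) (hg : g ∈ polyFun ι) :
    (fun p => f p - g p) ∈ polyFun ι := (polyFun ι).sub_mem hf hg

lemma mul_mem_polyFun {f g : (ι → ℝ × ℝ) → ℝ} (hf : f ∈ polyFun ι) (hg : g ∈ polyFun ι) :
    (fun p => f p * g p) ∈ polyFun ι := (polyFun ι).mul_mem hf hg

lemma div_mem_polyFun {f : (ι → ℝ × ℝ) → ℝ} (hf : f ∈ polyFun ι) (c : ℝ) :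
    (fun p => f p / c) ∈ polyFun ι := by
  simpa only [div_eq_mul_inv] using mul_mem_polyFun hf (const_mem_polyFun c⁻¹)

lemma pow_mem_polyFun {f : (ι → ℝ × ℝ) → ℝ} (hf : f ∈ polyFun ι) (n : ℕ) :
    (fun p => f p ^ n) ∈ polyFun ι := (polyFun ι).pow_mem hf n

lemma det_mem_polyFun {n : Type*} [Fintype n] [DecidableEq n] {M : (ι → ℝ × ℝ) → Matrix n n ℝ}
    (hM : ∀ a b, (fun p => M p a b) ∈ polyFun ι) : (fun p => (M p).det) ∈ polyFun ι := by
  have : (fun p => (M p).det) = ∑ σ : Equiv.Perm n, (Equiv.Perm.sign σ : ℤ) •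
      ∏ a, fun p => M p (σ a) a := by
    funext p
    simp [Matrix.det_apply, Units.smul_def]
  rw [this]
  exact sum_mem fun σ _ => zsmul_mem (prod_mem fun a _ => hM _ _) _

lemma nullFrame_mem_polyFun (i : Fin 2) (x : ι) (k : Fin 3) (m : Fin 4) :
    (fun p : ι → ℝ × ℝ => nullFrame i (p x) k m) ∈ polyFun ι := by
  have h1 := fst_mem_polyFun x
  have h2 := snd_mem_polyFun x
  have c0 : (fun _ => 0) ∈ polyFun ι := const_mem_polyFun 0
  have c1 : (fun _ => 1) ∈ polyFun ι := const_mem_polyFun 1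
  have h3 := mul_mem_polyFun h2 h1
  have h4 := div_mem_polyFun (add_mem_polyFun (pow_mem_polyFun h1 2) (pow_mem_polyFun h2 2)) 2
  fin_cases i <;> fin_cases k <;> fin_cases m <;> simpa [nullFrame]

lemma bilFunctional_mem_polyFun (i : Fin 2) {a b : (ι → ℝ × ℝ) → Fin 4 → ℝ}
    (ha : ∀ m, (fun p => a p m) ∈ polyFun ι) (hb : ∀ m, (fun p => b p m) ∈ polyFun ι)
    (m : Fin 9) : (fun p => bilFunctional i (a p) (b p) m) ∈ polyFun ι := by
  have h1 := fun k l => mul_mem_polyFun (ha k) (hb l)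
  have h2 := fun k l => add_mem_polyFun (h1 k l) (h1 l k)
  have h3 := fun k l k' l' => add_mem_polyFun (h2 k l) (h2 k' l')
  have h4 := fun k k' l' => add_mem_polyFun (h1 k k) (div_mem_polyFun (h2 k' l') 2)
  fin_cases i <;> fin_cases m <;> simp [bilFunctional] <;>
    first | exact h1 _ _ | exact h2 _ _ | exact h3 _ _ _ _ | exact h4 _ _ _

lemma jet_mem_polyFun (i : Fin 2) (x : ι) (j : Fin 3) (m : Fin 9) :
    (fun p : ι → ℝ × ℝ => jet i (p x) j m) ∈ polyFun ι :=
  bilFunctional_mem_polyFun i (nullFrame_mem_polyFun i x 0) (nullFrame_mem_polyFun i x j) m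

lemma nullPairing_mem_polyFun (i : Fin 2) (x y : ι) :
    (fun p : ι → ℝ × ℝ => nullPairing i (p x) (p y)) ∈ polyFun ι := by
  have h1 := sub_mem_polyFun (fst_mem_polyFun x) (fst_mem_polyFun y)
  have h2 := sub_mem_polyFun (snd_mem_polyFun x) (snd_mem_polyFun y)
  have h3 := mul_mem_polyFun h1 h2
  have h4 := div_mem_polyFun (add_mem_polyFun (pow_mem_polyFun h1 2) (pow_mem_polyFun h2 2)) 2
  fin_cases i <;> simpa [nullPairing]

lemma commonFunctional_mem_polyFun (i : Fin 2) (x y z : ι) (m : Fin 9) :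
    (fun p : ι → ℝ × ℝ => commonFunctional i (p x) (p y) (p z) m) ∈ polyFun ι := by
  have hb := fun u w => bilFunctional_mem_polyFun i (nullFrame_mem_polyFun (ι := ι) i u 0)
    (nullFrame_mem_polyFun i w 0) m
  have hn := nullPairing_mem_polyFun (ι := ι) i
  exact mul_mem_polyFun (hn y z)
    (sub_mem_polyFun (mul_mem_polyFun (hn x z) (hb x y)) (mul_mem_polyFun (hn x y) (hb x z)))

lemma jetMatrix_mem_polyFun (i : Fin 2) (x : Fin 4 → ι) (a b : Fin 9) :
    (fun p : ι → ℝ × ℝ => jetMatrix i (fun k => p (x k)) a b) ∈ polyFun ι := by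
  fin_cases a <;> exact jet_mem_polyFun i _ _ b

lemma commonMatrix_mem_polyFun (i : Fin 2) (a b : Fin 9) :
    (fun p => commonMatrix i p a b) ∈ polyFun (Fin 3 × Fin 4) := by
  fin_cases a <;> exact commonFunctional_mem_polyFun i _ _ _ b

lemma abs_le_of_abs_mulVec_le {n : ℕ} {M : Matrix (Fin n) (Fin n) ℝ} {L η δ : ℝ} (hL : 1 ≤ L)
    (hM : ∀ a b, |M a b| ≤ L) (hη : 0 < η) (hdet : η ≤ |M.det|) {c : Fin n → ℝ}
    (hc : ∀ a, |(M *ᵥ c) a| ≤ δ) (j : Fin n) : |c j| ≤ n * (n.factorial * L ^ n) * δ / η := by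
  have hadj : ∀ a b, |M.adjugate a b| ≤ n.factorial * L ^ n := by
    intro a b
    rw [Matrix.adjugate_apply]
    have := Matrix.det_le (A := M.updateRow b (Pi.single a 1)) (abv := AbsoluteValue.abs) (x := L)
      fun k l => by
        by_cases hk : k = b
        · subst hk
          by_cases hl : l = a <;> simp [hl, hL, zero_le_one.trans hL]
        · simpa [hk] using hM k l
    simpa using this
  have h1 : M.det * c j = ∑ b, M.adjugate j b * (M *ᵥ c) b := by
    have : M.adjugate *ᵥ (M *ᵥ c) = M.det • c := by
      rw [Matrix.mulVec_mulVec, Matrix.adjugate_mul, Matrix.smul_mulVec, Matrix.one_mulVec]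
    exact (congrFun this j).symm
  have h2 : |M.det| * |c j| ≤ n * (n.factorial * L ^ n) * δ := by
    rw [← abs_mul, h1]
    calc _ ≤ ∑ b, |M.adjugate j b * (M *ᵥ c) b| := Finset.abs_sum_le_sum_abs _ _
      _ ≤ ∑ _b : Fin n, n.factorial * L ^ n * δ := Finset.sum_le_sum fun b _ => by
          rw [abs_mul]
          exact mul_le_mul (hadj j b) (hc b) (abs_nonneg _) (by positivity)
      _ = _ := by simp; ring
  rw [le_div_iff₀ hη]
  nlinarith [abs_nonneg (c j)]

lemma card_image_floor_le {X : Type*} {m : ℕ} (Ω : Finset X) (w : X → Fin m → ℝ) (z : Fin m → ℝ)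
    {R δ : ℝ} (hδ : 0 < δ) (hR : 0 ≤ R) (h : ∀ x ∈ Ω, ∀ k, |w x k - z k| ≤ R * δ) :
    ((Ω.image fun x k => ⌊w x k / δ⌋).card : ℝ) ≤ (2 * R + 3) ^ m := by
  have hsub : (Ω.image fun x k => ⌊w x k / δ⌋) ⊆
      Fintype.piFinset fun k => Finset.Icc (⌊z k / δ⌋ - ⌊R + 1⌋) (⌊z k / δ⌋ + ⌊R + 1⌋) := by
    intro c hc
    obtain ⟨x, hx, rfl⟩ := Finset.mem_image.1 hc
    rw [Fintype.mem_piFinset]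
    intro k
    have h1 := abs_le.1 (h x hx k)
    have h2 : w x k / δ ≤ z k / δ + R := by
      rw [div_le_iff₀ hδ, add_mul, div_mul_cancel₀ _ hδ.ne']
      linarith
    have h3 : z k / δ ≤ w x k / δ + R := by
      rw [div_le_iff₀ hδ, add_mul, div_mul_cancel₀ _ hδ.ne']
      linarith
    have e1 := Int.floor_le (w x k / δ)
    have e2 := Int.lt_floor_add_one (w x k / δ)
    have e3 := Int.floor_le (z k / δ)
    have e4 := Int.lt_floor_add_one (z k / δ)
    have f1 : ⌊w x k / δ⌋ - ⌊z k / δ⌋ ≤ ⌊R + 1⌋ := Int.le_floor.2 (by push_cast; linarith)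
    have f2 : ⌊z k / δ⌋ - ⌊w x k / δ⌋ ≤ ⌊R + 1⌋ := Int.le_floor.2 (by push_cast; linarith)
    rw [Finset.mem_Icc]
    omega
  have hR1 : 0 ≤ ⌊R + 1⌋ := Int.floor_nonneg.2 (by linarith)
  refine (Nat.cast_le.2 (Finset.card_le_card hsub)).trans ?_
  rw [Fintype.card_piFinset]
  push_cast
  have : ∀ k : Fin m, ((Finset.Icc (⌊z k / δ⌋ - ⌊R + 1⌋) (⌊z k / δ⌋ + ⌊R + 1⌋)).card : ℝ) ≤
      2 * R + 3 := by
    intro k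
    rw [Int.card_Icc]
    have e : ((⌊z k / δ⌋ + ⌊R + 1⌋ + 1 - (⌊z k / δ⌋ - ⌊R + 1⌋)).toNat : ℤ) = 2 * ⌊R + 1⌋ + 1 := by
      omega
    have e' : ((⌊z k / δ⌋ + ⌊R + 1⌋ + 1 - (⌊z k / δ⌋ - ⌊R + 1⌋)).toNat : ℝ) =
      2 * ⌊R + 1⌋ + 1 := by exact_mod_cast e
    rw [e']
    have := Int.floor_le (R + 1)
    linarith
  exact (Finset.prod_le_prod (fun _ _ => by positivity) fun k _ => this k).trans (by simp)

lemma card_le_of_injOn_floor {X : Type*} {m : ℕ} {Ω : Finset X} {w : X → Fin m → ℝ} {δ : ℝ}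
    (hinj : Set.InjOn (fun x k => ⌊w x k / δ⌋) Ω) {Ω' : Finset X} (hΩ' : Ω' ⊆ Ω) (z : Fin m → ℝ)
    {R : ℝ} (hδ : 0 < δ) (hR : 0 ≤ R) (h : ∀ x ∈ Ω', ∀ k, |w x k - z k| ≤ R * δ) :
    (Ω'.card : ℝ) ≤ (2 * R + 3) ^ m := by
  rw [← Finset.card_image_of_injOn (hinj.mono (Finset.coe_subset.2 hΩ'))]
  exact card_image_floor_le Ω' w z hδ hR h

end CoreInequality

/-- Finite families of polynomial functions are uniformly bounded on the box. -/
lemma exists_bound_of_mem_polyFun {ι κ : Type*} [Finite κ] (f : κ → (ι → ℝ × ℝ) → ℝ)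
    (hf : ∀ k, f k ∈ polyFun ι) :
    ∃ L : ℝ, ∀ k p, (∀ a, InBox (p a)) → |f k p| ≤ L := by
  choose P hP using fun k => exists_eval_eq_of_mem_polyFun (hf k)
  choose L _ h1 _ using fun k => exists_bound_and_lipschitz (P k) 1 zero_le_one
  obtain ⟨B, hB⟩ := (Set.finite_range L).bddAbove
  refine ⟨B, fun k p hp => ?_⟩
  rw [hP]
  refine (h1 k _ ?_).trans (hB ⟨k, rfl⟩)
  rintro ⟨a, b⟩
  fin_cases b
  · exact (hp a).1
  · exact (hp a).2

lemma exists_polynomial_eval_eq_dets (i : Fin 2) :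
    ∃ P : MvPolynomial ((Fin 3 × Fin 4) × Fin 2) ℝ, P ≠ 0 ∧ ∀ p : Fin 3 × Fin 4 → ℝ × ℝ,
      MvPolynomial.eval (coordVal p) P =
        (∏ j, (jetMatrix i fun b => p (j, b)).det) * (commonMatrix i p).det := by
  choose PJ hPJ using fun j : Fin 3 => exists_eval_eq_of_mem_polyFun
    (det_mem_polyFun (jetMatrix_mem_polyFun i fun b => ((j, b) : Fin 3 × Fin 4)))
  obtain ⟨PK, hPK⟩ := exists_eval_eq_of_mem_polyFun (det_mem_polyFun (commonMatrix_mem_polyFun i))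
  refine ⟨(∏ j, PJ j) * PK, mul_ne_zero (Finset.prod_ne_zero_iff.2 fun j _ h0 => ?_)
    fun h0 => ?_, fun p => ?_⟩
  · obtain ⟨q, hq⟩ := exists_jetMatrix_det_ne_zero i
    exact hq (by simpa [h0] using hPJ j fun a => q a.2)
  · obtain ⟨q, hq⟩ := exists_commonMatrix_det_ne_zero i
    exact hq (by simpa [h0] using hPK q)
  · rw [map_mul, map_prod, ← hPK]
    exact congrArg (· * _) (Finset.prod_congr rfl fun j _ => (hPJ j p).symm)

lemma exists_bound_jetMatrix_commonMatrix (i : Fin 2) :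
    ∃ L : ℝ, 1 ≤ L ∧ ∀ p : Fin 3 × Fin 4 → ℝ × ℝ, (∀ a, InBox (p a)) →
      (∀ j a b, |jetMatrix i (fun b => p (j, b)) a b| ≤ L) ∧
      (∀ a b, |commonMatrix i p a b| ≤ L) ∧
      (∀ j, |(jetMatrix i fun b => p (j, b)).det| ≤ L) ∧ |(commonMatrix i p).det| ≤ L := by
  have hJ := fun j : Fin 3 => jetMatrix_mem_polyFun i fun b => ((j, b) : Fin 3 × Fin 4)
  obtain ⟨L1, h1⟩ := exists_bound_of_mem_polyFun
    (fun (k : Fin 3 × Fin 9 × Fin 9) p => jetMatrix i (fun b => p (k.1, b)) k.2.1 k.2.2)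
    fun k => hJ _ _ _
  obtain ⟨L2, h2⟩ := exists_bound_of_mem_polyFun
    (fun (k : Fin 9 × Fin 9) p => commonMatrix i p k.1 k.2) fun k => commonMatrix_mem_polyFun i _ _
  obtain ⟨L3, h3⟩ := exists_bound_of_mem_polyFun
    (fun (j : Fin 3) p => (jetMatrix i fun b => p (j, b)).det) fun j => det_mem_polyFun (hJ j)
  obtain ⟨L4, h4⟩ := exists_bound_of_mem_polyFun
    (fun (_ : Unit) p => (commonMatrix i p).det) fun _ =>
      det_mem_polyFun (commonMatrix_mem_polyFun i)
  refine ⟨max 1 (max (max L1 L2) (max L3 L4)), le_max_left _ _, fun p hp =>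
    ⟨fun j a b => (h1 (j, a, b) p hp).trans ?_, fun a b => (h2 (a, b) p hp).trans ?_,
    fun j => (h3 j p hp).trans ?_, (h4 () p hp).trans ?_⟩⟩ <;> simp

/-- A family of twelve points at which the jets are quantitatively in general position satisfies a
Brascamp-Lieb type inequality for counting functions. -/
lemma exists_card_pow_le_of_general_position (i : Fin 2) {c₀ : ℝ} (hc₀ : 0 ≤ c₀) :
    ∃ P : MvPolynomial ((Fin 3 × Fin 4) × Fin 2) ℝ, P ≠ 0 ∧ ∃ C : ℝ, 1 ≤ C ∧
      ∀ p : Fin 3 × Fin 4 → ℝ × ℝ, (∀ a, InBox (p a)) → ∀ η : ℝ, 0 < η → η ≤ 1 →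
      η ≤ |MvPolynomial.eval (coordVal p) P| →
      ∀ {X α : Type} (Ω : Finset X) (v : X → Fin 9 → ℝ) (δ : ℝ), 0 < δ →
      Set.InjOn (fun x k => ⌊v x k / δ⌋) Ω → ∀ (F : Fin 3 × Fin 4 → X → α) (N : ℝ), 0 < N →
      (∀ a, ((Ω.image (F a)).card : ℝ) ≤ N) →
      (∀ a, ∀ x ∈ Ω, ∀ y ∈ Ω, F a y = F a x → ∀ j, |jet i (p a) j ⬝ᵥ (v y - v x)| ≤ c₀ * δ) →
      (Ω.card : ℝ) ^ 4 ≤ N ^ 12 * (C / η) ^ 90 := by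
  obtain ⟨P, hP0, hP⟩ := exists_polynomial_eval_eq_dets i
  obtain ⟨D, hD1, hD⟩ := exists_bound_jetMatrix_commonMatrix i
  obtain ⟨G, hG⟩ : ∃ G : ℝ, G = (9 : ℕ) * ((Nat.factorial 9) * D ^ 9) := ⟨_, rfl⟩
  have hGpos : 0 < G := by rw [hG]; positivity
  refine ⟨P, hP0, 2 * (G * (c₀ + 1) * D ^ 3) + 640 * c₀ + 3, ?_, ?_⟩
  · have : 0 ≤ G * (c₀ + 1) * D ^ 3 := by positivity
    linarith
  intro p hp η hη hη1 hηP X α Ω v δ hδ hinj F N hN hF hjet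
  obtain ⟨hLJ, hLK, hdJ, hdK⟩ := hD p hp
  rw [hP, Fin.prod_univ_three, abs_mul, abs_mul, abs_mul] at hηP
  have four : ∀ a b c d : ℝ, 0 ≤ a → 0 ≤ b → 0 ≤ c → 0 ≤ d → b ≤ D → c ≤ D → d ≤ D →
      η ≤ a * b * c * d → η / D ^ 3 ≤ a := by
    intro a b c d ha hb hc hd hbD hcD hdD h
    rw [div_le_iff₀ (by positivity)]
    have h1 : b * c * d ≤ D * D * D := by gcongr
    have h2 := mul_le_mul_of_nonneg_left h1 ha
    nlinarith
  have hD0 : 0 < η / D ^ 3 := by positivity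
  have hdetK : η / D ^ 3 ≤ |(commonMatrix i p).det| :=
    four _ _ _ _ (abs_nonneg _) (abs_nonneg _) (abs_nonneg _) (abs_nonneg _) (hdJ 0) (hdJ 1)
      (hdJ 2) (by linarith)
  have hdetJ : ∀ j, η / D ^ 3 ≤ |(jetMatrix i fun b => p (j, b)).det| := by
    rw [Fin.forall_fin_succ, Fin.forall_fin_two]
    refine ⟨four _ _ _ _ (abs_nonneg _) (abs_nonneg _) (abs_nonneg _) (abs_nonneg _) (hdJ 1)
      (hdJ 2) hdK hηP, four _ _ _ _ (abs_nonneg _) (abs_nonneg _) (abs_nonneg _) (abs_nonneg _)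
      (hdJ 0) (hdJ 2) hdK (hηP.trans_eq ?_), four _ _ _ _ (abs_nonneg _) (abs_nonneg _)
      (abs_nonneg _) (abs_nonneg _) (hdJ 0) (hdJ 1) hdK (hηP.trans_eq ?_)⟩
    · exact congrArg (· * _ * _) (mul_comm _ _)
    · exact congrArg (· * _) ((mul_comm _ _).trans (mul_assoc _ _ _).symm)
  have hsolve : ∀ (M : Matrix (Fin 9) (Fin 9) ℝ) (c : ℝ), c ≤ c₀ + 1 → 0 ≤ c →
      (∀ a b, |M a b| ≤ D) → η / D ^ 3 ≤ |M.det| → ∀ w : Fin 9 → ℝ,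
      (∀ a, |(M *ᵥ w) a| ≤ c * δ) → ∀ k, |w k| ≤ G * (c₀ + 1) * D ^ 3 / η * δ := by
    intro M c hc hc0 hM hdet w hw k
    refine (abs_le_of_abs_mulVec_le hD1 hM hD0 hdet hw k).trans ?_
    rw [← hG]
    have : G * (c * δ) / (η / D ^ 3) = G * c * D ^ 3 / η * δ := by
      field_simp
    rw [this]
    gcongr
  have hκle : ∀ R : ℝ, 0 ≤ R → R ≤ G * (c₀ + 1) * D ^ 3 / η →
      2 * R + 3 ≤ (2 * (G * (c₀ + 1) * D ^ 3) + 640 * c₀ + 3) / η := by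
    intro R hR0 hR
    rw [le_div_iff₀ hη]
    rw [le_div_iff₀ hη] at hR
    nlinarith
  have hjm : ∀ j : Fin 3, ∀ x ∈ Ω, ∀ y ∈ Ω, (∀ a, F (j, a) y = F (j, a) x) →
      ∀ k, |(v y - v x) k| ≤ G * (c₀ + 1) * D ^ 3 / η * δ := by
    intro j x hx y hy h
    refine hsolve _ c₀ (by linarith) hc₀ (hLJ j)
      (hdetJ j) _ fun a => ?_
    have := fun b => hjet (j, b) x hx y hy (h b)
    fin_cases a
    exacts [this 0 0, this 0 1, this 0 2, this 1 0, this 1 1, this 1 2, this 2 0, this 2 1,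
      this 3 0]
  have hC1 : 1 ≤ (2 * (G * (c₀ + 1) * D ^ 3) + 640 * c₀ + 3) / η := by
    have := hκle 0 le_rfl (by positivity)
    linarith
  have himg : ∀ (j : Fin 3) (Ω' : Finset X) (x : X),
      (∀ y ∈ Ω', ∀ m, |commonTriple i (fun b => p (j, b)) m ⬝ᵥ (v y - v x)| ≤ 320 * (c₀ * δ)) →
      ((Ω'.image fun y m => ⌊(commonTriple i (fun b => p (j, b)) m ⬝ᵥ v y) / δ⌋).card : ℝ) ≤
        ((2 * (G * (c₀ + 1) * D ^ 3) + 640 * c₀ + 3) / η) ^ 9 := by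
    intro j Ω' x h
    have h1 := card_image_floor_le Ω' (fun y m => commonTriple i (fun b => p (j, b)) m ⬝ᵥ v y)
      (fun m => commonTriple i (fun b => p (j, b)) m ⬝ᵥ v x) (R := 320 * c₀) hδ (by positivity)
      fun y hy m => by
        have := h y hy m
        rw [dotProduct_sub] at this
        linarith
    refine h1.trans ?_
    have h2 : 2 * (320 * c₀) + 3 ≤ (2 * (G * (c₀ + 1) * D ^ 3) + 640 * c₀ + 3) / η := by
      rw [le_div_iff₀ hη]
      have : 0 ≤ G * (c₀ + 1) * D ^ 3 := by positivity
      nlinarith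
    calc _ ≤ ((2 * (G * (c₀ + 1) * D ^ 3) + 640 * c₀ + 3) / η) ^ 3 := by gcongr
      _ ≤ _ := pow_le_pow_right₀ hC1 (by norm_num)
  have hfin : ∀ x ∈ Ω, ((Ω.filter fun y => ∀ j : Fin 3,
      (fun m => ⌊(commonTriple i (fun b => p (j, b)) m ⬝ᵥ v y) / δ⌋) =
        fun m => ⌊(commonTriple i (fun b => p (j, b)) m ⬝ᵥ v x) / δ⌋).card : ℝ) ≤
      ((2 * (G * (c₀ + 1) * D ^ 3) + 640 * c₀ + 3) / η) ^ 9 := by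
    intro x hx
    refine (card_le_of_injOn_floor hinj (Finset.filter_subset _ _) (v x)
      (R := G * (c₀ + 1) * D ^ 3 / η) hδ (by positivity) fun y hy k => ?_).trans
      (pow_le_pow_left₀ (by positivity) (hκle _ (by positivity) le_rfl) 9)
    obtain ⟨hy, h⟩ := Finset.mem_filter.1 hy
    refine hsolve (commonMatrix i p) 1 (by linarith) zero_le_one hLK hdetK (v y - v x)
      (fun a => ?_) k
    have hd : ∀ j m, |commonTriple i (fun b => p (j, b)) m ⬝ᵥ (v y - v x)| ≤ 1 * δ := by
      intro j m
      have e : ⌊_ / δ⌋ = ⌊_ / δ⌋ := congrFun (h j) m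
      have := (Int.abs_sub_lt_one_of_floor_eq_floor e).le
      rwa [← sub_div, ← dotProduct_sub, abs_div, abs_of_pos hδ, div_le_iff₀ hδ] at this
    fin_cases a
    exacts [hd 0 0, hd 0 1, hd 0 2, hd 1 0, hd 1 1, hd 1 2, hd 2 0, hd 2 1, hd 2 2]
  have key := card_pow_le_of_groups (Ω := Ω) (fun j a => F (j, a))
    (fun j y m => ⌊(commonTriple i (fun b => p (j, b)) m ⬝ᵥ v y) / δ⌋) hN
    (κ := ((2 * (G * (c₀ + 1) * D ^ 3) + 640 * c₀ + 3) / η) ^ 9) (by positivity)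
    (fun j a => hF (j, a)) ?_ ?_ ?_ ?_
  · rwa [← pow_mul] at key
  · intro j x hx
    have := himg j (Ω.filter fun y => F (j, 0) y = F (j, 0) x ∧ F (j, 1) y = F (j, 1) x) x
      ?_
    · convert this
    intro y hy
    obtain ⟨hy, h0, h1⟩ := Finset.mem_filter.1 hy
    exact abs_commonTriple_dotProduct_le_left i (fun a => hp (j, a))
      (hjet (j, 0) x hx y hy h0) (hjet (j, 1) x hx y hy h1)
  · intro j x hx
    have := himg j (Ω.filter fun y => F (j, 2) y = F (j, 2) x ∧ F (j, 3) y = F (j, 3) x) x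
      ?_
    · convert this
    intro y hy
    obtain ⟨hy, h0, h1⟩ := Finset.mem_filter.1 hy
    exact abs_commonTriple_dotProduct_le_right i (fun a => hp (j, a))
      (hjet (j, 2) x hx y hy h0) (hjet (j, 3) x hx y hy h1)
  · intro j x hx
    refine (card_le_of_injOn_floor hinj (Finset.filter_subset _ _) (v x)
      (R := G * (c₀ + 1) * D ^ 3 / η) hδ (by positivity) fun y hy k => ?_).trans
      (pow_le_pow_left₀ (by positivity) (hκle _ (by positivity) le_rfl) 9)
    obtain ⟨hy, h⟩ := Finset.mem_filter.1 hy
    exact hjm j x hx y hy h k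
  · intro x hx
    refine le_trans ?_ (hfin x hx)
    exact le_of_eq (by congr)

section AdjointAction

lemma abs_apply_le_mnorm (X : M4) (a b : Fin 4) : |X a b| ≤ mnorm X :=
  le_ciSup (f := fun p : Fin 4 × Fin 4 => |X p.1 p.2|) (Set.finite_range _).bddAbove (a, b)

lemma mnorm_le {X : M4} {ρ : ℝ} (h : ∀ a b, |X a b| ≤ ρ) : mnorm X ≤ ρ :=
  ciSup_le fun p => h p.1 p.2

lemma isUnit_det_Qmat (i : Fin 2) : IsUnit (Qmat i).det := by
  refine Matrix.isUnit_det_of_left_inverse (B := if i = 0 then (4 : ℝ) • Qmat i else Qmat i) ?_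
  fin_cases i <;> ext a b <;> fin_cases a <;> fin_cases b <;>
    simp [Qmat, Matrix.mul_apply, Fin.sum_univ_four] <;> norm_num

lemma mem_rSpace_iff {i : Fin 2} {X : M4} :
    X ∈ rSpace i ↔ X.trace = 0 ∧ X * Qmat i = Qmat i * Xᵀ := by
  have h : X ∈ rSpace i ↔ X.trace = 0 ∧ -(Qmat i * Xᵀ * (Qmat i)⁻¹) + X = 0 := Iff.rfl
  rw [h, neg_add_eq_zero, and_congr_right_iff]
  intro _
  constructor
  · intro e
    conv_lhs => rw [← e]
    rw [Matrix.nonsing_inv_mul_cancel_right _ _ (isUnit_det_Qmat i)]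
  · intro e
    rw [← e, Matrix.mul_nonsing_inv_cancel_right _ _ (isUnit_det_Qmat i)]

lemma mem_rSpace_zero_iff {X : M4} : X ∈ rSpace 0 ↔ X 1 3 = -X 0 2 ∧ X 2 3 = -X 0 1 ∧
    X 3 3 = X 0 0 ∧ X 1 1 = -X 0 0 ∧ X 2 2 = -X 0 0 ∧ X 3 2 = -X 1 0 ∧ X 3 1 = -X 2 0 := by
  rw [mem_rSpace_iff, ← Matrix.ext_iff]
  simp [Fin.forall_fin_succ, Qmat, Matrix.mul_apply, Fin.sum_univ_four, Matrix.trace]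
  grind

lemma mem_rSpace_one_iff {X : M4} : X ∈ rSpace 1 ↔ X 1 3 = -X 0 1 ∧ X 2 3 = -X 0 2 ∧
    X 3 3 = X 0 0 ∧ X 2 1 = X 1 2 ∧ X 0 0 = -((X 1 1 + X 2 2) / 2) ∧ X 3 1 = -X 1 0 ∧
    X 3 2 = -X 2 0 := by
  rw [mem_rSpace_iff, ← Matrix.ext_iff]
  simp [Fin.forall_fin_succ, Qmat, Matrix.mul_apply, Fin.sum_univ_four, Matrix.trace]
  grind

lemma abs_rCoord_le_mnorm (i : Fin 2) (X : M4) (k : Fin 9) : |rCoord i X k| ≤ mnorm X := by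
  have h := abs_apply_le_mnorm X
  fin_cases i <;> fin_cases k <;> simp [rCoord, h]

lemma rCoord_sub (i : Fin 2) (X Y : M4) : rCoord i (X - Y) = rCoord i X - rCoord i Y := by
  funext k
  fin_cases i <;> fin_cases k <;> simp [rCoord] <;> ring

lemma mnorm_le_of_abs_rCoord_le {i : Fin 2} {X : M4} (hX : X ∈ rSpace i) {ρ : ℝ}
    (h : ∀ k, |rCoord i X k| ≤ ρ) : mnorm X ≤ ρ := by
  simp only [Fin.forall_fin_succ] at h
  refine mnorm_le fun a b => ?_
  fin_cases i
  · obtain ⟨h1, h2, h3, h4, h5, h6, h7⟩ := mem_rSpace_zero_iff.1 hX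
    simp [rCoord] at h
    fin_cases a <;> fin_cases b <;> simp [*]
  · obtain ⟨h1, h2, h3, h4, h5, h6, h7⟩ := mem_rSpace_one_iff.1 hX
    simp [rCoord] at h
    have h0 : |X 0 0| ≤ ρ := by
      obtain ⟨_, _, _, _, ha, _, hb, _⟩ := h
      rw [h5]
      rw [abs_le] at *
      constructor <;> linarith
    clear h5
    fin_cases a <;> fin_cases b <;> simp [*]

lemma uMat_mul_uMat_neg (i : Fin 2) (r s : ℝ) : uMat i r s * uMat i (-r) (-s) = 1 := by
  fin_cases i <;> ext a b <;> fin_cases a <;> fin_cases b <;>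
    simp [uMat, Matrix.mul_apply, Fin.sum_univ_four] <;> ring

lemma uMat_inv (i : Fin 2) (r s : ℝ) : (uMat i r s)⁻¹ = uMat i (-r) (-s) :=
  Matrix.inv_eq_right_inv (uMat_mul_uMat_neg i r s)

lemma uMat_mul_Qmat (i : Fin 2) (r s : ℝ) :
    uMat i r s * Qmat i = Qmat i * (uMat i (-r) (-s))ᵀ := by
  fin_cases i <;> ext a b <;> fin_cases a <;> fin_cases b <;>
    simp [uMat, Qmat, Matrix.mul_apply, Fin.sum_univ_four] <;> ring

lemma Adm_uMat_mem_rSpace {i : Fin 2} (r s : ℝ) {X : M4} (hX : X ∈ rSpace i) :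
    Adm (uMat i r s) X ∈ rSpace i := by
  obtain ⟨h1, h2⟩ := mem_rSpace_iff.1 hX
  refine mem_rSpace_iff.2 ⟨?_, ?_⟩
  · rw [Adm, Matrix.trace_mul_cycle, Matrix.nonsing_inv_mul, one_mul, h1]
    exact Matrix.isUnit_det_of_right_inverse (uMat_mul_uMat_neg i r s)
  · have h3 := uMat_mul_Qmat i (-r) (-s)
    rw [neg_neg, neg_neg] at h3
    rw [Adm, uMat_inv, mul_assoc, h3, Matrix.transpose_mul, Matrix.transpose_mul, ← mul_assoc,
      ← mul_assoc, ← uMat_mul_Qmat, mul_assoc (uMat i r s), h2]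
    simp only [mul_assoc]

/-- The column in which a jet functional appears in the first row of a matrix. -/
def jetColumn (i : Fin 2) (j : Fin 3) : Fin 4 := if i = 0 then ![3, 2, 1] j else ![3, 1, 2] j

lemma abs_jet_dotProduct_rCoord {i : Fin 2} (p : ℝ × ℝ) {X : M4} (hX : X ∈ rSpace i) (j : Fin 3) :
    |jet i p j ⬝ᵥ rCoord i X| = |Adm (uMat i p.1 p.2) X 0 (jetColumn i j)| := by
  suffices h : jet i p j ⬝ᵥ rCoord i X =
      (if j = 0 then -1 else 1) * Adm (uMat i p.1 p.2) X 0 (jetColumn i j) by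
    rw [h]
    split_ifs <;> simp
  rw [Adm, uMat_inv]
  fin_cases i
  · obtain ⟨h1, h2, h3, h4, h5, h6, h7⟩ := mem_rSpace_zero_iff.1 hX
    fin_cases j <;>
      simp [jet, bilFunctional, nullFrame, rCoord, uMat, jetColumn, Matrix.mul_apply,
        Matrix.vecMul, dotProduct, Fin.sum_univ_succ, h1,
        h2, h3, h4, h5, h6, h7] <;> ring
  · obtain ⟨h1, h2, h3, h4, h5, h6, h7⟩ := mem_rSpace_one_iff.1 hX
    fin_cases j <;>
      simp [jet, bilFunctional, nullFrame, rCoord, uMat, jetColumn, Matrix.mul_apply,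
        Matrix.vecMul, dotProduct, Fin.sum_univ_succ, h1,
        h2, h3, h4, h5, h6, h7] <;> ring

lemma rUp_le_rSpace (i : Fin 2) (l : ℤ) : rUp i l ≤ rSpace i :=
  iSup₂_le fun _ _ => inf_le_left

lemma mem_rUp_of_forall {i : Fin 2} {l μ : ℤ} (hl : l ≤ μ) {X : M4} (hX : X ∈ rSpace i)
    (h : ∀ a b, ((![1, 0, 0, -1] : Fin 4 → ℝ) a - (![1, 0, 0, -1] : Fin 4 → ℝ) b) * X a b =
      μ * X a b) : X ∈ rUp i l := by
  refine Submodule.mem_iSup_of_mem μ (Submodule.mem_iSup_of_mem hl ⟨hX, ?_⟩)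
  have : adA X = (μ : ℝ) • X := by
    ext a b
    rw [Matrix.smul_apply, smul_eq_mul, ← h]
    simp only [adA, aWt, LinearMap.coe_mk, AddHom.coe_mk, Matrix.sub_apply, Matrix.diagonal_mul,
      Matrix.mul_diagonal]
    ring
  simp [this]

lemma apply_jetColumn_eq_zero {i : Fin 2} {Z : M4} (hZ : Z ∈ rSpace i)
    (h : ∀ Y ∈ rUp i 1, tinner Z Y = 0) (j : Fin 3) : Z 0 (jetColumn i j) = 0 := by
  have e3 : (!![0, 0, 0, 1; 0, 0, 0, 0; 0, 0, 0, 0; 0, 0, 0, 0] : M4) ∈ rUp i 1 := by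
    refine mem_rUp_of_forall (μ := 2) (by norm_num) ?_ ?_
    · fin_cases i
      · simp [mem_rSpace_zero_iff]
      · simp [mem_rSpace_one_iff]
    · norm_num [Fin.forall_fin_succ]
  have e3' := h _ e3
  fin_cases i
  · have e1 : (!![0, 1, 0, 0; 0, 0, 0, 0; 0, 0, 0, -1; 0, 0, 0, 0] : M4) ∈ rUp 0 1 := by
      refine mem_rUp_of_forall (μ := 1) le_rfl (by simp [mem_rSpace_zero_iff]) ?_
      norm_num [Fin.forall_fin_succ]
    have e2 : (!![0, 0, 1, 0; 0, 0, 0, -1; 0, 0, 0, 0; 0, 0, 0, 0] : M4) ∈ rUp 0 1 := by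
      refine mem_rUp_of_forall (μ := 1) le_rfl (by simp [mem_rSpace_zero_iff]) ?_
      norm_num [Fin.forall_fin_succ]
    have e1' := h _ e1
    have e2' := h _ e2
    obtain ⟨h1, h2, -⟩ := mem_rSpace_zero_iff.1 hZ
    simp [tinner, Matrix.trace, Fin.sum_univ_four, Matrix.mul_apply, h1, h2] at e1' e2' e3'
    fin_cases j <;> simp [jetColumn] <;> linarith
  · have e1 : (!![0, 1, 0, 0; 0, 0, 0, -1; 0, 0, 0, 0; 0, 0, 0, 0] : M4) ∈ rUp 1 1 := by
      refine mem_rUp_of_forall (μ := 1) le_rfl (by simp [mem_rSpace_one_iff]) ?_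
      norm_num [Fin.forall_fin_succ]
    have e2 : (!![0, 0, 1, 0; 0, 0, 0, 0; 0, 0, 0, -1; 0, 0, 0, 0] : M4) ∈ rUp 1 1 := by
      refine mem_rUp_of_forall (μ := 1) le_rfl (by simp [mem_rSpace_one_iff]) ?_
      norm_num [Fin.forall_fin_succ]
    have e1' := h _ e1
    have e2' := h _ e2
    obtain ⟨h1, h2, -⟩ := mem_rSpace_one_iff.1 hZ
    simp [tinner, Matrix.trace, Fin.sum_univ_four, Matrix.mul_apply, h1, h2] at e1' e2' e3'
    fin_cases j <;> simp [jetColumn] <;> linarith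

lemma Adm_sub (g X Y : M4) : Adm g (X - Y) = Adm g X - Adm g Y := by
  simp [Adm, mul_sub, sub_mul]

/-- The jets of `X - Y` are controlled by the distance of the projections of the translates. -/
lemma abs_jet_dotProduct_le {i : Fin 2} {π : M4 → M4}
    (hπ : ∀ X ∈ rSpace i, π X ∈ rUp i 1 ∧ ∀ Y ∈ rUp i 1, tinner (X - π X) Y = 0) (p : ℝ × ℝ)
    {X Y : M4} (hX : X ∈ rSpace i) (hY : Y ∈ rSpace i) (j : Fin 3) :
    |jet i p j ⬝ᵥ (rCoord i X - rCoord i Y)| ≤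
      mnorm (π (Adm (uMat i p.1 p.2) X) - π (Adm (uMat i p.1 p.2) Y)) := by
  have key : ∀ Z ∈ rSpace i, Z 0 (jetColumn i j) = π Z 0 (jetColumn i j) := fun Z hZ =>
    sub_eq_zero.1 (apply_jetColumn_eq_zero
      (sub_mem hZ (rUp_le_rSpace i 1 (hπ Z hZ).1)) (hπ Z hZ).2 j)
  rw [← rCoord_sub, abs_jet_dotProduct_rCoord p (sub_mem hX hY), Adm_sub, Matrix.sub_apply,
    key _ (Adm_uMat_mem_rSpace _ _ hX), key _ (Adm_uMat_mem_rSpace _ _ hY), ← Matrix.sub_apply]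
  exact abs_apply_le_mnorm _ _ _

end AdjointAction

section Covering

lemma exists_cover_card_eq_covNum {δ : ℝ} {S : Set M4}
    (h : ∃ T : Finset M4, S ⊆ ⋃ c ∈ T, {y : M4 | mnorm (y - c) ≤ δ}) :
    ∃ T : Finset M4, T.card = covNum δ S ∧ ∀ X ∈ S, ∃ c ∈ T, mnorm (X - c) ≤ δ := by
  obtain ⟨T, hT⟩ := h
  obtain ⟨T', h1, h2⟩ := Nat.sInf_mem (s := {n : ℕ | ∃ t : Finset M4, t.card = n ∧
    S ⊆ ⋃ c ∈ t, {y : M4 | mnorm (y - c) ≤ δ}}) ⟨_, T, rfl, hT⟩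
  refine ⟨T', h1, fun X hX => ?_⟩
  obtain ⟨c, hc, hXc⟩ := Set.mem_iUnion₂.1 (h2 hX)
  exact ⟨c, hc, hXc⟩

/-- A function with fibres of diameter at most `δ` gives a covering by balls of radius `δ`. -/
lemma exists_cover_card_le {δ : ℝ} {S : Set M4} {β : Type*} (f : M4 → β) (V : Finset β)
    (hV : ∀ X ∈ S, f X ∈ V) (h : ∀ X ∈ S, ∀ Y ∈ S, f X = f Y → mnorm (X - Y) ≤ δ) :
    ∃ T : Finset M4, T.card ≤ V.card ∧ S ⊆ ⋃ c ∈ T, {y : M4 | mnorm (y - c) ≤ δ} := by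
  choose! g hg using fun (v : β) (hv : ∃ X ∈ S, f X = v) => hv
  refine ⟨V.image g, Finset.card_image_le, fun X hX => ?_⟩
  have hgX := hg (f X) ⟨X, hX, rfl⟩
  exact Set.mem_iUnion₂.2 ⟨g (f X), Finset.mem_image_of_mem _ (hV X hX),
    h X hX _ hgX.1 hgX.2.symm⟩

lemma abs_sub_le_of_floor_div_eq {x y δ : ℝ} (hδ : 0 < δ) (h : ⌊x / δ⌋ = ⌊y / δ⌋) :
    |x - y| ≤ δ := by
  have := (Int.abs_sub_lt_one_of_floor_eq_floor h).le
  rwa [← sub_div, abs_div, abs_of_pos hδ, div_le_one hδ] at this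

lemma floor_div_mem_Icc {x R δ : ℝ} (hδ : 0 < δ) (h : |x| ≤ R) :
    ⌊x / δ⌋ ∈ Finset.Icc ⌊-R / δ⌋ ⌊R / δ⌋ := by
  have := abs_le.1 h
  exact Finset.mem_Icc.2 ⟨Int.floor_le_floor (by gcongr; exact this.1),
    Int.floor_le_floor (by gcongr; exact this.2)⟩

lemma exists_cover_of_mnorm_le {δ R : ℝ} (hδ : 0 < δ) {S : Set M4} (h : ∀ X ∈ S, mnorm X ≤ R) :
    ∃ T : Finset M4, S ⊆ ⋃ c ∈ T, {y : M4 | mnorm (y - c) ≤ δ} := by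
  obtain ⟨T, -, hT⟩ := exists_cover_card_le (δ := δ) (S := S)
    (fun X (p : Fin 4 × Fin 4) => ⌊X p.1 p.2 / δ⌋)
    (Fintype.piFinset fun _ => Finset.Icc ⌊-R / δ⌋ ⌊R / δ⌋)
    (fun X hX => Fintype.mem_piFinset.2 fun p =>
      floor_div_mem_Icc hδ ((abs_apply_le_mnorm X _ _).trans (h X hX)))
    fun X _ Y _ hXY => mnorm_le fun a b => abs_sub_le_of_floor_div_eq hδ (congrFun hXY (a, b))
  exact ⟨T, hT⟩

/-- The index of the `δ`-cell of `rSpace i` containing `X`. -/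
noncomputable def rCell (i : Fin 2) (δ : ℝ) (X : M4) : Fin 9 → ℤ := fun k => ⌊rCoord i X k / δ⌋

lemma finite_rCell_image {i : Fin 2} {δ R : ℝ} (hδ : 0 < δ) {S : Set M4}
    (h : ∀ X ∈ S, mnorm X ≤ R) : (rCell i δ '' S).Finite := by
  refine (Finset.finite_toSet
    (Fintype.piFinset fun _ : Fin 9 => Finset.Icc ⌊-R / δ⌋ ⌊R / δ⌋)).subset ?_
  rintro _ ⟨X, hX, rfl⟩
  exact Fintype.mem_piFinset.2 fun k =>
    floor_div_mem_Icc hδ ((abs_rCoord_le_mnorm i X k).trans (h X hX))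

lemma covNum_le_card_rCell {i : Fin 2} {δ : ℝ} (hδ : 0 < δ) {S : Set M4}
    (hS : ∀ X ∈ S, X ∈ rSpace i) {V : Finset (Fin 9 → ℤ)} (hV : ∀ X ∈ S, rCell i δ X ∈ V) :
    covNum δ S ≤ V.card := by
  obtain ⟨T, hT, hST⟩ := exists_cover_card_le (δ := δ) (rCell i δ) V hV
    fun X hX Y hY hXY => mnorm_le_of_abs_rCoord_le (sub_mem (hS X hX) (hS Y hY)) fun k => by
      rw [rCoord_sub]
      exact abs_sub_le_of_floor_div_eq hδ (congrFun hXY k)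
  exact (Nat.sInf_le (m := T.card) (by exact ⟨T, rfl, hST⟩)).trans hT

lemma card_rCell_le {i : Fin 2} {δ R : ℝ} (hδ : 0 < δ) {S : Set M4}
    (h : ∀ X ∈ S, mnorm X ≤ R) {V : Finset (Fin 9 → ℤ)} (hV : ∀ v ∈ V, ∃ X ∈ S, rCell i δ X = v) :
    (V.card : ℝ) ≤ 5 ^ 9 * covNum δ S := by
  obtain ⟨T, hT, hST⟩ := exists_cover_card_eq_covNum (exists_cover_of_mnorm_le hδ h)
  choose! x hxS hx using hV
  choose! c hcT hc using hST
  rw [← hT]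
  have hfib : ∀ d ∈ T, ((V.filter fun v => c (x v) = d).card : ℝ) ≤ 5 ^ 9 := by
    intro d _
    refine (card_le_of_injOn_floor (Ω := V) (w := fun v => rCoord i (x v)) (δ := δ)
      (fun v hv v' hv' e => ?_) (Finset.filter_subset _ _) (rCoord i d) (R := 1) hδ zero_le_one
      fun v hv k => ?_).trans (by norm_num)
    · rw [← hx v hv, ← hx v' hv']
      exact e
    · obtain ⟨hv', hd⟩ := Finset.mem_filter.1 hv
      rw [← hd, one_mul, ← Pi.sub_apply, ← rCoord_sub]
      exact (abs_rCoord_le_mnorm i _ k).trans (hc _ (hxS v hv'))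
  rw [Finset.card_eq_sum_card_fiberwise (f := fun v => c (x v)) (t := T)
    fun v hv => hcT _ (hxS v hv)]
  push_cast
  exact (Finset.sum_le_sum hfib).trans (by simp [mul_comm])

lemma tinner_eq_sum (X Y : M4) : tinner X Y = ∑ a, ∑ b, X a b * Y a b := by
  simp [tinner, Matrix.trace, Matrix.mul_apply]

lemma mnorm_le_of_tinner_sub_eq_zero {X Z : M4} (h : tinner (Z - X) X = 0) {R : ℝ} (hR : 0 ≤ R)
    (hZ : mnorm Z ≤ R) : mnorm X ≤ 4 * R := by
  rw [tinner_eq_sum] at h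
  have h1 : ∑ a, ∑ b, X a b ^ 2 ≤ ∑ a, ∑ b, Z a b ^ 2 := by
    have : 0 ≤ ∑ a, ∑ b, (Z a b - X a b) ^ 2 :=
      Finset.sum_nonneg fun _ _ => Finset.sum_nonneg fun _ _ => sq_nonneg _
    have e : ∑ a, ∑ b, Z a b ^ 2 = ∑ a, ∑ b, X a b ^ 2 + ∑ a, ∑ b, (Z a b - X a b) ^ 2 +
        2 * ∑ a, ∑ b, (Z - X) a b * X a b := by
      simp only [Finset.mul_sum, ← Finset.sum_add_distrib, Matrix.sub_apply]
      refine Finset.sum_congr rfl fun a _ => Finset.sum_congr rfl fun b _ => ?_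
      ring
    rw [e, h]
    linarith
  have h2 : ∑ a, ∑ b, Z a b ^ 2 ≤ 16 * R ^ 2 := by
    calc _ ≤ ∑ _a : Fin 4, ∑ _b : Fin 4, R ^ 2 :=
          Finset.sum_le_sum fun a _ => Finset.sum_le_sum fun b _ =>
            sq_le_sq.2 (((abs_apply_le_mnorm Z a b).trans hZ).trans (le_abs_self R))
      _ = _ := by simp; ring
  refine mnorm_le fun a b => abs_le_of_sq_le_sq (a := X a b) ?_ (by positivity)
  have h3 : X a b ^ 2 ≤ ∑ b, X a b ^ 2 := Finset.single_le_sum (f := fun b => X a b ^ 2)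
    (fun _ _ => sq_nonneg _) (Finset.mem_univ b)
  have h4 : ∑ b, X a b ^ 2 ≤ ∑ a, ∑ b, X a b ^ 2 := Finset.single_le_sum
    (f := fun a => ∑ b, X a b ^ 2) (fun _ _ => Finset.sum_nonneg fun _ _ => sq_nonneg _)
    (Finset.mem_univ a)
  nlinarith

lemma mnorm_mul_le (X Y : M4) : mnorm (X * Y) ≤ 4 * (mnorm X * mnorm Y) := by
  refine mnorm_le fun a b => ?_
  rw [Matrix.mul_apply]
  refine (Finset.abs_sum_le_sum_abs _ _).trans ?_
  calc _ ≤ ∑ _c : Fin 4, mnorm X * mnorm Y := Finset.sum_le_sum fun c _ => by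
        rw [abs_mul]
        exact mul_le_mul (abs_apply_le_mnorm X a c) (abs_apply_le_mnorm Y c b) (abs_nonneg _)
          ((abs_nonneg _).trans (abs_apply_le_mnorm X a c))
    _ = _ := by simp

lemma mnorm_uMat_le (i : Fin 2) {r s : ℝ} (hr : |r| ≤ 1) (hs : |s| ≤ 1) :
    mnorm (uMat i r s) ≤ 1 := by
  have h1 : |s| * |r| ≤ 1 := mul_le_one₀ hs (abs_nonneg _) hr
  have h2 : |(r ^ 2 + s ^ 2) / 2| ≤ 1 := by
    rw [abs_of_nonneg (by positivity)]
    nlinarith [(sq_le_one_iff_abs_le_one r).2 hr, (sq_le_one_iff_abs_le_one s).2 hs]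
  refine mnorm_le fun a b => ?_
  fin_cases i <;> fin_cases a <;> fin_cases b <;> simp [uMat, hr, hs, h1, h2]

lemma mnorm_Adm_uMat_le (i : Fin 2) {r s : ℝ} (hr : |r| ≤ 1) (hs : |s| ≤ 1) {X : M4}
    (hX : mnorm X ≤ 1) : mnorm (Adm (uMat i r s) X) ≤ 16 := by
  have h0 : ∀ X : M4, 0 ≤ mnorm X := fun X => (abs_nonneg _).trans (abs_apply_le_mnorm X 0 0)
  rw [Adm, uMat_inv]
  refine (mnorm_mul_le _ _).trans ?_
  have h1 := mnorm_mul_le (uMat i r s) X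
  have h2 := mul_le_one₀ (mnorm_uMat_le i hr hs) (h0 X) hX
  have h3 := mnorm_uMat_le i (r := -r) (s := -s) (by simpa) (by simpa)
  nlinarith [mul_le_mul (h1.trans (mul_le_mul_of_nonneg_left h2 (by norm_num))) h3 (h0 _)
    (by norm_num)]

end Covering

section Selection

/-- Among many tuples of dense subsets, one outside a small exceptional set has a large
intersection. -/
lemma exists_tuple_card_inter_ge {X γ ι : Type*} [Fintype ι] [Nonempty ι] {Ω : Finset X}
    (hΩ : Ω.Nonempty) {H : Finset γ} (B : γ → Finset X) (hB : ∀ h ∈ H, B h ⊆ Ω) {β : ℝ}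
    (hβ : 0 ≤ β) (hcard : ∀ h ∈ H, β * Ω.card ≤ (B h).card) {bad : Finset (ι → γ)}
    (hbad : (bad.card : ℝ) < β ^ Fintype.card ι / 2 * (H.card : ℝ) ^ Fintype.card ι) :
    ∃ g : ι → γ, (∀ a, g a ∈ H) ∧ g ∉ bad ∧ β ^ Fintype.card ι / 2 * Ω.card ≤
      ((Ω.filter fun x => ∀ a, x ∈ B (g a)).card : ℝ) := by
  by_contra! hcon
  obtain ⟨n, hn⟩ : ∃ n, Fintype.card ι = n + 1 := Nat.exists_eq_succ_of_ne_zero Fintype.card_ne_zero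
  simp only [hn] at hbad hcon
  have hΩ0 : (0 : ℝ) < Ω.card := by exact_mod_cast hΩ.card_pos
  have h1 : ∑ g ∈ Fintype.piFinset fun _ : ι => H,
      ((Ω.filter fun x => ∀ a, x ∈ B (g a)).card : ℝ) =
      ∑ x ∈ Ω, ((H.filter fun h => x ∈ B h).card : ℝ) ^ (n + 1) := by
    have : ∀ x : X, ((H.filter fun h => x ∈ B h).card) ^ (n + 1) =
        ((Fintype.piFinset fun _ : ι => H).filter fun g => ∀ a, x ∈ B (g a)).card := by
      intro x
      have : ((Fintype.piFinset fun _ : ι => H).filter fun g => ∀ a, x ∈ B (g a)) =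
          Fintype.piFinset fun _ : ι => H.filter fun h => x ∈ B h := by
        ext g
        simp [forall_and]
      rw [this, Fintype.card_piFinset, Finset.prod_const, Finset.card_univ, hn]
    norm_cast
    simp_rw [this, Finset.card_filter]
    exact Finset.sum_comm
  have h2 : ∑ x ∈ Ω, ((H.filter fun h => x ∈ B h).card : ℝ) = ∑ h ∈ H, ((B h).card : ℝ) := by
    have : ∀ h ∈ H, (B h).card = (Ω.filter fun x => x ∈ B h).card := fun h hh => by
      rw [Finset.filter_mem_eq_inter, Finset.inter_eq_right.2 (hB h hh)]
    norm_cast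
    rw [Finset.sum_congr rfl this]
    simp_rw [Finset.card_filter]
    exact Finset.sum_comm
  have h3 : β ^ (n + 1) * Ω.card * (H.card : ℝ) ^ (n + 1) ≤
      ∑ x ∈ Ω, ((H.filter fun h => x ∈ B h).card : ℝ) ^ (n + 1) := by
    refine le_trans ?_ (pow_sum_div_card_le_sum_pow (n := n) fun x _ => Nat.cast_nonneg _)
    have h4 : H.card * (β * Ω.card) ≤ ∑ x ∈ Ω, ((H.filter fun h => x ∈ B h).card : ℝ) := by
      rw [h2, ← nsmul_eq_mul]
      exact Finset.card_nsmul_le_sum _ _ _ hcard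
    rw [le_div_iff₀ (by positivity)]
    calc _ = (H.card * (β * Ω.card)) ^ (n + 1) := by ring
      _ ≤ _ := by gcongr
  have h5 : ∑ g ∈ Fintype.piFinset fun _ : ι => H,
      ((Ω.filter fun x => ∀ a, x ∈ B (g a)).card : ℝ) ≤
      bad.card * Ω.card + (H.card : ℝ) ^ (n + 1) * (β ^ (n + 1) / 2 * Ω.card) := by
    have h6 : ∀ g ∈ Fintype.piFinset fun _ : ι => H,
        ((Ω.filter fun x => ∀ a, x ∈ B (g a)).card : ℝ) ≤
          (if g ∈ bad then (Ω.card : ℝ) else 0) + β ^ (n + 1) / 2 * Ω.card := by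
      intro g hg
      split_ifs with hgb
      · have : ((Ω.filter fun x => ∀ a, x ∈ B (g a)).card : ℝ) ≤ Ω.card := by
          exact_mod_cast Finset.card_filter_le _ _
        have : 0 ≤ β ^ (n + 1) / 2 * Ω.card := by positivity
        linarith
      · rw [zero_add]
        exact (hcon g (Fintype.mem_piFinset.1 hg) hgb).le
    refine (Finset.sum_le_sum h6).trans ?_
    rw [Finset.sum_add_distrib, Finset.sum_const, Fintype.card_piFinset, Finset.prod_const,
      Finset.card_univ, hn, nsmul_eq_mul, ← Finset.sum_filter, Finset.sum_const, nsmul_eq_mul,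
      Nat.cast_pow]
    gcongr
    intro g hg
    exact (Finset.mem_filter.1 hg).2
  rw [h1] at h5
  nlinarith [h3.trans h5, mul_lt_mul_of_pos_right hbad hΩ0]

/-- The cells of side `1 / K` meeting a subset of the plane. -/
noncomputable def gridCell (K : ℕ) (u : ℝ × ℝ) : ℤ × ℤ := (⌊u.1 * K⌋, ⌊u.2 * K⌋)

lemma abs_sub_gridCell_le {K : ℕ} (hK : 0 < K) (x : ℝ) : |x - (⌊x * K⌋ : ℝ) / K| ≤ 1 / K := by
  have hK' : (0 : ℝ) < K := by exact_mod_cast hK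
  have h1 := Int.floor_le (x * K)
  have h2 := (Int.lt_floor_add_one (x * K)).le
  rw [abs_le, neg_le_sub_iff_le_add, sub_le_iff_le_add, ← add_div, div_le_iff₀ hK',
    le_div_iff₀ hK', add_mul, div_mul_cancel₀ _ hK'.ne']
  constructor <;> linarith

lemma volume_le_card_gridCell {K : ℕ} (hK : 0 < K) {S : Set (ℝ × ℝ)} {H : Finset (ℤ × ℤ)}
    (hH : ∀ u ∈ S, gridCell K u ∈ H) :
    volume S ≤ ENNReal.ofReal (H.card / (K : ℝ) ^ 2) := by
  have hK' : (0 : ℝ) < K := by exact_mod_cast hK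
  have hsub : S ⊆ ⋃ h ∈ H, Set.Icc ((h.1 : ℝ) / K) ((h.1 : ℝ) / K + 1 / K) ×ˢ
      Set.Icc ((h.2 : ℝ) / K) ((h.2 : ℝ) / K + 1 / K) := by
    intro u hu
    refine Set.mem_iUnion₂.2 ⟨gridCell K u, hH u hu, ?_⟩
    have h : ∀ x : ℝ, x ∈ Set.Icc ((⌊x * K⌋ : ℝ) / K) ((⌊x * K⌋ : ℝ) / K + 1 / K) := by
      intro x
      rw [Set.mem_Icc, ← add_div, div_le_iff₀ hK', le_div_iff₀ hK']
      exact ⟨Int.floor_le _, (Int.lt_floor_add_one _).le⟩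
    exact ⟨h u.1, h u.2⟩
  calc volume S ≤ ∑ h ∈ H, volume (Set.Icc ((h.1 : ℝ) / K) ((h.1 : ℝ) / K + 1 / K) ×ˢ
        Set.Icc ((h.2 : ℝ) / K) ((h.2 : ℝ) / K + 1 / K)) :=
        (measure_mono hsub).trans (measure_biUnion_finset_le _ _)
    _ = ∑ _h ∈ H, ENNReal.ofReal (1 / (K : ℝ) ^ 2) := by
        refine Finset.sum_congr rfl fun h _ => ?_
        rw [Measure.volume_eq_prod, Measure.prod_prod, Real.volume_Icc, Real.volume_Icc,
          add_sub_cancel_left, add_sub_cancel_left, ← ENNReal.ofReal_mul (by positivity)]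
        congr 1
        field_simp
    _ = _ := by
        rw [Finset.sum_const, nsmul_eq_mul, ← ENNReal.ofReal_natCast,
          ← ENNReal.ofReal_mul (Nat.cast_nonneg _), mul_one_div]

end Selection

section GeneralPosition

lemma exists_card_bad_tuples_le {ι : Type*} [Fintype ι] (P : MvPolynomial (ι × Fin 2) ℝ)
    (hP : P ≠ 0) :
    ∃ (C : ℝ) (m : ℕ), 0 < C ∧ ∀ (K : ℕ) (τ : ℝ), 0 < τ → τ ≤ 1 → 1 ≤ K * τ →
      ∀ H : Finset (ℤ × ℤ),
      (∀ h ∈ H, h.1 ∈ Finset.Icc (-(K : ℤ)) K ∧ h.2 ∈ Finset.Icc (-(K : ℤ)) K) →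
      (((Fintype.piFinset fun _ : ι => H).filter fun g =>
        |MvPolynomial.eval (coordVal fun a => (((g a).1 : ℝ) / K, ((g a).2 : ℝ) / K)) P| ≤
          τ ^ m).card : ℝ) ≤ C * τ * K ^ (2 * Fintype.card ι) := by
  obtain ⟨C, m, hC, h⟩ := exists_card_grid_small_le P hP
  refine ⟨C, m, hC, fun K τ hτ hτ1 hK H hH => le_trans ?_ ((h K τ hτ hτ1 hK).trans_eq ?_)⟩
  · norm_cast
    refine Finset.card_le_card_of_injOn (fun g a => ![(g a.1).1, (g a.1).2] a.2)
      (fun g hg => ?_) fun g _ g' _ e => ?_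
    · obtain ⟨h1, h2⟩ := Finset.mem_filter.1 hg
      rw [Fintype.mem_piFinset] at h1
      refine Finset.mem_filter.2 ⟨(@Fintype.mem_piFinset _ (_) _ _ _ _).2 ?_, ?_⟩
      · rintro ⟨a, b⟩
        fin_cases b
        exacts [(hH _ (h1 a)).1, (hH _ (h1 a)).2]
      · convert h2 using 4
        funext ⟨a, b⟩
        fin_cases b <;> simp [coordVal]
    · funext a
      exact Prod.ext (congrFun e (a, 0)) (congrFun e (a, 1))
  · rw [Fintype.card_prod, Fintype.card_fin, mul_comm 2]

lemma floor_mul_mem_Icc {K : ℕ} {x : ℝ} (hx : |x| ≤ 1) :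
    ⌊x * K⌋ ∈ Finset.Icc (-(K : ℤ)) K := by
  obtain ⟨h1, h2⟩ := abs_le.1 hx
  have hK : (0 : ℝ) ≤ K := Nat.cast_nonneg K
  rw [Finset.mem_Icc, Int.le_floor, Int.floor_le_iff]
  push_cast
  constructor <;> nlinarith

lemma inBox_of_mem_uSq {u : ℝ × ℝ} (hu : u ∈ uSq) : InBox u :=
  ⟨abs_le.2 hu.1, abs_le.2 hu.2⟩

/-- Dense subsets indexed by a set of points of measure more than `t` have a large intersection
along some tuple of points at which a given nonzero polynomial is not too small. -/
lemma exists_tuple_abs_eval_ge {ι : Type*} [Fintype ι] [Nonempty ι]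
    (P : MvPolynomial (ι × Fin 2) ℝ) (hP : P ≠ 0) {q : ℝ} (hq : 1 ≤ q) :
    ∃ (c : ℝ) (m : ℕ), 0 < c ∧ c ≤ 1 ∧ ∀ t : ℝ, 0 < t → t ≤ 1 → ∀ E ⊆ uSq,
      ENNReal.ofReal t < mU E → ∀ {X : Type} (Ω : Finset X), Ω.Nonempty →
      ∀ B : ℝ × ℝ → Finset X, (∀ u ∈ E, B u ⊆ Ω ∧ t / q * Ω.card ≤ (B u).card) →
      ∃ (p : ι → ℝ × ℝ) (Ω' : Finset X), (∀ a, p a ∈ E) ∧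
        c * t ^ m ≤ |MvPolynomial.eval (coordVal p) P| ∧ (∀ a, ∀ x ∈ Ω', x ∈ B (p a)) ∧
        (t / q) ^ Fintype.card ι / 2 * Ω.card ≤ (Ω'.card : ℝ) := by
  obtain ⟨C, m, hC, hbad⟩ := exists_card_bad_tuples_le P hP
  obtain ⟨L, hL0, -, hL⟩ := exists_bound_and_lipschitz P 1 zero_le_one
  obtain ⟨n, hn⟩ : ∃ n, Fintype.card ι = n := ⟨_, rfl⟩
  simp only [hn] at hbad ⊢
  obtain ⟨c, hc⟩ : ∃ c : ℝ, c = 1 / (4 * q ^ n * (C + 1)) := ⟨_, rfl⟩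
  have hc0 : 0 < c := by rw [hc]; positivity
  have hc1 : c ≤ 1 := by
    rw [hc, div_le_one (by positivity)]
    nlinarith [one_le_pow₀ hq (n := n)]
  refine ⟨c ^ m / 2, 2 * n * m, by positivity, ?_, ?_⟩
  · linarith [pow_le_one₀ hc0.le hc1 (n := m)]
  intro t ht ht1 E hE hEt X Ω hΩ B hB
  obtain ⟨τ, hτ⟩ : ∃ τ : ℝ, τ = c * t ^ (2 * n) := ⟨_, rfl⟩
  have hτ0 : 0 < τ := by rw [hτ]; positivity
  have hτ1 : τ ≤ 1 := by
    rw [hτ]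
    exact mul_le_one₀ hc1 (by positivity) (pow_le_one₀ ht.le ht1)
  obtain ⟨K, hK⟩ := exists_nat_ge (max (1 / τ) (2 * L / τ ^ m))
  have hK1 : 1 ≤ K * τ := (div_le_iff₀ hτ0).1 ((le_max_left _ _).trans hK)
  have hK2 : 2 * L ≤ K * τ ^ m := (div_le_iff₀ (by positivity)).1 ((le_max_right _ _).trans hK)
  have hK0 : 0 < K := Nat.pos_of_ne_zero fun h => by norm_num [h] at hK1
  have hK0' : (0 : ℝ) < K := by exact_mod_cast hK0
  have hfin : (gridCell K '' E).Finite := by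
    refine (Finset.finite_toSet
      (Finset.Icc (-(K : ℤ)) K ×ˢ Finset.Icc (-(K : ℤ)) K)).subset ?_
    rintro _ ⟨u, hu, rfl⟩
    have hu' := inBox_of_mem_uSq (hE hu)
    exact Finset.mem_product.2 ⟨floor_mul_mem_Icc hu'.1, floor_mul_mem_Icc hu'.2⟩
  obtain ⟨H, hH⟩ : ∃ H : Finset (ℤ × ℤ), ∀ h, h ∈ H ↔ ∃ u ∈ E, gridCell K u = h :=
    ⟨hfin.toFinset, fun h => by simp⟩
  choose! u huE hu using fun h => (hH h).1
  have hHK : ∀ h ∈ H, h.1 ∈ Finset.Icc (-(K : ℤ)) K ∧ h.2 ∈ Finset.Icc (-(K : ℤ)) K := by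
    intro h hh
    have hu' := inBox_of_mem_uSq (hE (huE h hh))
    rw [← hu h hh]
    exact ⟨floor_mul_mem_Icc hu'.1, floor_mul_mem_Icc hu'.2⟩
  have hHcard : t * (K : ℝ) ^ 2 ≤ H.card := by
    by_contra! hlt
    refine hEt.not_ge ?_
    have hvol := volume_le_card_gridCell hK0 (S := E) (H := H)
      fun u hu => (hH _).2 ⟨u, hu, rfl⟩
    refine ENNReal.div_le_of_le_mul (hvol.trans ?_)
    have h4 : (4 : ENNReal) = ENNReal.ofReal 4 := by norm_num
    rw [h4, ← ENNReal.ofReal_mul ht.le]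
    refine ENNReal.ofReal_le_ofReal ?_
    rw [div_le_iff₀ (by positivity)]
    nlinarith [pow_pos hK0' 2]
  have hcount := hbad K τ hτ0 hτ1 hK1 H hHK
  have hlt : C * τ * (K : ℝ) ^ (2 * n) < (t / q) ^ n / 2 * (H.card : ℝ) ^ n := by
    calc C * τ * (K : ℝ) ^ (2 * n) < (t / q) ^ n / 2 * (t * (K : ℝ) ^ 2) ^ n := by
          rw [hτ, hc]
          have e : C * (1 / (4 * q ^ n * (C + 1)) * t ^ (2 * n)) * (K : ℝ) ^ (2 * n) =
              C / (2 * (C + 1)) * ((t / q) ^ n / 2 * (t * (K : ℝ) ^ 2) ^ n) := by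
            rw [div_pow, mul_pow, ← pow_mul, pow_mul' t 2 n]
            field_simp
            ring
          rw [e]
          refine mul_lt_of_lt_one_left (by positivity) ?_
          rw [div_lt_one (by positivity)]
          linarith
      _ ≤ _ := by gcongr
  have hsel := exists_tuple_card_inter_ge (ι := ι) hΩ (H := H) (fun h => B (u h))
    (fun h hh => (hB _ (huE h hh)).1) (β := t / q) (by positivity)
    (fun h hh => (hB _ (huE h hh)).2) (bad := (Fintype.piFinset fun _ : ι => H).filter fun g =>
      |MvPolynomial.eval (coordVal fun a => (((g a).1 : ℝ) / K, ((g a).2 : ℝ) / K)) P| ≤ τ ^ m)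
    (by rw [hn]; exact hcount.trans_lt hlt)
  obtain ⟨g, hgH, hg, hgcard⟩ := hsel
  rw [hn] at hgcard
  refine ⟨fun a => u (g a), Ω.filter fun x => ∀ a, x ∈ B (u (g a)), fun a => huE _ (hgH a), ?_,
    fun a x hx => (Finset.mem_filter.1 hx).2 a, hgcard⟩
  rw [Finset.mem_filter, not_and, not_le] at hg
  have h1 := hg (Fintype.mem_piFinset.2 hgH)
  have habs : ∀ z ∈ Finset.Icc (-(K : ℤ)) K, |(z : ℝ) / K| ≤ 1 := by
    intro z hz
    rw [abs_div, abs_of_pos hK0', div_le_one hK0', abs_le]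
    exact_mod_cast Finset.mem_Icc.1 hz
  have h2 := hL (coordVal fun a => u (g a))
    (coordVal fun a => (((g a).1 : ℝ) / K, ((g a).2 : ℝ) / K)) (1 / K) ?_ ?_ ?_ (by positivity)
  · have h3 : L * (1 / K) ≤ τ ^ m / 2 := by
      rw [mul_one_div, div_le_iff₀ hK0']
      linarith
    have h4 := abs_sub_abs_le_abs_sub
      (MvPolynomial.eval (coordVal fun a => (((g a).1 : ℝ) / K, ((g a).2 : ℝ) / K)) P)
      (MvPolynomial.eval (coordVal fun a => u (g a)) P)
    rw [abs_sub_comm] at h4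
    have h5 : c ^ m / 2 * t ^ (2 * n * m) = τ ^ m / 2 := by
      rw [hτ, mul_pow, ← pow_mul]
      ring
    linarith
  · rintro ⟨a, b⟩
    have := inBox_of_mem_uSq (hE (huE _ (hgH a)))
    fin_cases b
    exacts [this.1, this.2]
  · rintro ⟨a, b⟩
    fin_cases b
    exacts [habs _ (hHK _ (hgH a)).1, habs _ (hHK _ (hgH a)).2]
  · rintro ⟨a, b⟩
    have h6 := hu _ (hgH a)
    have h7 := abs_sub_gridCell_le hK0 (u (g a)).1
    have h8 := abs_sub_gridCell_le hK0 (u (g a)).2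
    have h9 : ⌊(u (g a)).1 * K⌋ = (g a).1 := congrArg Prod.fst h6
    have h10 : ⌊(u (g a)).2 * K⌋ = (g a).2 := congrArg Prod.snd h6
    rw [h9] at h7
    rw [h10] at h8
    fin_cases b
    exacts [h7, h8]

end GeneralPosition

section ExceptionalSet

lemma exists_abs_jet_dotProduct_le (i : Fin 2) :
    ∃ L : ℝ, 0 ≤ L ∧ ∀ p, InBox p → ∀ (j : Fin 3) (w : Fin 9 → ℝ) (δ : ℝ), (∀ k, |w k| ≤ δ) →
      |jet i p j ⬝ᵥ w| ≤ L * δ := by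
  obtain ⟨L, hL⟩ := exists_bound_of_mem_polyFun
    (fun (k : Fin 3 × Fin 9) (p : Unit → ℝ × ℝ) => jet i (p ()) k.1 k.2)
    fun k => jet_mem_polyFun i () k.1 k.2
  have hL0 : 0 ≤ L := (abs_nonneg _).trans (hL (0, 0) (fun _ => 0) fun _ => by simp [InBox])
  refine ⟨9 * L, by positivity, fun p hp j w δ hw => ?_⟩
  calc |jet i p j ⬝ᵥ w| ≤ ∑ k, |jet i p j k * w k| := Finset.abs_sum_le_sum_abs _ _
    _ ≤ ∑ _k : Fin 9, L * δ := Finset.sum_le_sum fun k _ => by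
        rw [abs_mul]
        exact mul_le_mul (hL (j, k) (fun _ => p) fun _ => hp) (hw k) (abs_nonneg _) hL0
    _ = 9 * L * δ := by simp; ring

/-- Points are encoded by the elements of an optimal covering of the projection of a translate. -/
lemma exists_code {i : Fin 2} {π : M4 → M4}
    (hπ : ∀ X ∈ rSpace i, π X ∈ rUp i 1 ∧ ∀ Y ∈ rUp i 1, tinner (X - π X) Y = 0) {δ : ℝ}
    (hδ : 0 < δ) {S : Set M4} (hS : S ⊆ {X : M4 | X ∈ rSpace i ∧ mnorm X ≤ 1}) {p : ℝ × ℝ}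
    (hp : InBox p) :
    ∃ (T : Finset M4) (code : M4 → M4),
      T.card = covNum δ (π '' ((fun X => Adm (uMat i p.1 p.2) X) '' S)) ∧
      (∀ X ∈ S, code X ∈ T) ∧ ∀ X ∈ S, ∀ Y ∈ S, code X = code Y → ∀ j,
        |jet i p j ⬝ᵥ (rCoord i X - rCoord i Y)| ≤ 2 * δ := by
  have hbound : ∀ Z ∈ π '' ((fun X => Adm (uMat i p.1 p.2) X) '' S), mnorm Z ≤ 4 * 16 := by
    rintro _ ⟨_, ⟨X, hX, rfl⟩, rfl⟩
    have h := hπ _ (Adm_uMat_mem_rSpace p.1 p.2 (hS hX).1)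
    exact mnorm_le_of_tinner_sub_eq_zero (h.2 _ h.1) (by norm_num)
      (mnorm_Adm_uMat_le i hp.1 hp.2 (hS hX).2)
  obtain ⟨T, hT, hcov⟩ := exists_cover_card_eq_covNum (exists_cover_of_mnorm_le hδ hbound)
  choose! d hdT hd using fun X (hX : X ∈ S) => hcov _ ⟨_, ⟨X, hX, rfl⟩, rfl⟩
  refine ⟨T, d, hT, hdT, fun X hX Y hY hXY j => ?_⟩
  refine (abs_jet_dotProduct_le hπ p (hS hX).1 (hS hY).1 j).trans (mnorm_le fun a b => ?_)
  have h1 := (abs_apply_le_mnorm _ a b).trans (hd X hX)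
  have h2 := (abs_apply_le_mnorm _ a b).trans (hd Y hY)
  rw [← hXY] at h2
  rw [Matrix.sub_apply, abs_le] at h1 h2 ⊢
  constructor <;> linarith

lemma pow_exponents_absurd {q c C κ t n₀ n a : ℝ} {m : ℕ} (hq1 : 1 ≤ q) (hc0 : 0 < c)
    (hC1 : 1 ≤ C) (ht : 0 < t) (ht1 : t ≤ 1) (hκ : κ = 16 * q ^ 48 * (C / c) ^ 90) (hκ1 : 1 ≤ κ)
    (htκ : t ≤ 1 / (2 * κ)) (hn₀ : 0 < n₀) (ha : 0 ≤ a) (han : a ≤ n₀)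
    (h1 : (t / q) ^ 12 / 2 * n₀ ≤ n)
    (hcore : n ^ 4 ≤ t ^ (60 + 96 * m) * a ^ 4 * (C / (c * t ^ m)) ^ 90) : False := by
  have h3 : ((t / q) ^ 12 / 2) ^ 4 * n₀ ^ 4 ≤
      t ^ (60 + 96 * m) * (C / (c * t ^ m)) ^ 90 * n₀ ^ 4 := by
    rw [← mul_pow]
    refine (pow_le_pow_left₀ (by positivity) h1 4).trans (hcore.trans ?_)
    rw [mul_right_comm]
    gcongr
  have h4 := le_of_mul_le_mul_right h3 (by positivity)
  have e1 : t ^ (60 + 96 * m) * (C / (c * t ^ m)) ^ 90 =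
      t ^ 48 * (C / c) ^ 90 * (t ^ (11 + 6 * m) * t) := by
    have : t ^ (60 + 96 * m) = t ^ 48 * (t ^ (11 + 6 * m) * t) * (t ^ m) ^ 90 := by ring
    rw [this, ← div_div, div_pow (C / c), mul_assoc, mul_div_cancel₀ _ (by positivity)]
    ring
  have e2 : ((t / q) ^ 12 / 2) ^ 4 = t ^ 48 / (16 * q ^ 48) := by
    rw [div_pow, div_pow, div_pow, ← pow_mul, ← pow_mul, div_div, mul_comm (q ^ _)]
    norm_num
  rw [e1, e2, div_le_iff₀ (by positivity)] at h4
  have h5 : t ^ 48 * 1 ≤ t ^ 48 * (κ * (t ^ (11 + 6 * m) * t)) := by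
    rw [hκ]
    linarith
  have h6 := le_of_mul_le_mul_left h5 (by positivity)
  have h7 : t ^ (11 + 6 * m) * t ≤ t := mul_le_of_le_one_left ht.le (pow_le_one₀ ht.le ht1)
  rw [le_div_iff₀ (by positivity)] at htκ
  have h8 := mul_le_mul_of_nonneg_left h7 (zero_le_one.trans hκ1)
  linarith

lemma exists_mU_exceptional_le (i : Fin 2) :
    ∃ (M : ℕ) (t₀ : ℝ), 1 ≤ M ∧ 0 < t₀ ∧ t₀ ≤ 1 ∧ ∀ t : ℝ, 0 < t → t ≤ t₀ → ∀ δ : ℝ, 0 < δ →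
      ∀ A : Set M4, A ⊆ {X : M4 | X ∈ rSpace i ∧ mnorm X ≤ 1} → ∀ π : M4 → M4,
      (∀ X ∈ rSpace i, π X ∈ rUp i 1 ∧ ∀ Y ∈ rUp i 1, tinner (X - π X) Y = 0) →
      mU {p ∈ uSq | ∃ A' ⊆ A, t * (covNum δ A : ℝ) ≤ (covNum δ A' : ℝ) ∧
        ((covNum δ (π '' ((fun X => Adm (uMat i p.1 p.2) X) '' A')) : ℝ) <
          t ^ M * (covNum δ A : ℝ) ^ ((1 : ℝ) / 3))} ≤ ENNReal.ofReal t := by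
  obtain ⟨L, hL0, hL⟩ := exists_abs_jet_dotProduct_le i
  obtain ⟨P, hP0, C, hC1, hP⟩ :=
    exists_card_pow_le_of_general_position i (c₀ := 2 + 2 * L) (by positivity)
  obtain ⟨q, hq⟩ : ∃ q : ℝ, q = 5 ^ 9 := ⟨_, rfl⟩
  have hq1 : 1 ≤ q := by rw [hq]; norm_num
  obtain ⟨c, m, hc0, hc1, hsel⟩ := exists_tuple_abs_eval_ge P hP0 hq1
  obtain ⟨κ, hκ⟩ : ∃ κ : ℝ, κ = 16 * q ^ 48 * (C / c) ^ 90 := ⟨_, rfl⟩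
  have hκ1 : 1 ≤ κ := by
    have h1 : 1 ≤ (C / c) ^ 90 := one_le_pow₀ ((one_le_div hc0).2 (hc1.trans hC1))
    have h2 : 1 ≤ q ^ 48 := one_le_pow₀ hq1
    rw [hκ]
    nlinarith [mul_le_mul h2 h1 zero_le_one (by positivity)]
  refine ⟨5 + 8 * m, 1 / (2 * κ), by omega, by positivity, ?_, ?_⟩
  · rw [div_le_one (by positivity)]
    linarith
  intro t ht htκ δ hδ A hA π hπ
  have ht1 : t ≤ 1 := htκ.trans (by rw [div_le_one (by positivity)]; linarith)
  by_contra! hlt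
  obtain ⟨E, hE⟩ : ∃ E : Set (ℝ × ℝ), E = {p ∈ uSq | ∃ A' ⊆ A,
    t * (covNum δ A : ℝ) ≤ (covNum δ A' : ℝ) ∧
      ((covNum δ (π '' ((fun X => Adm (uMat i p.1 p.2) X) '' A')) : ℝ) <
        t ^ (5 + 8 * m) * (covNum δ A : ℝ) ^ ((1 : ℝ) / 3))} := ⟨_, rfl⟩
  rw [← hE] at hlt
  have hEsq : E ⊆ uSq := fun u hu => by rw [hE] at hu; exact hu.1
  have hEne : E.Nonempty := by
    by_contra! h0
    rw [h0] at hlt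
    simp [mU] at hlt
  choose! A' hA' hdense hsmall using fun u (hu : u ∈ E) => (hE ▸ hu : u ∈ {p ∈ uSq | _}).2
  obtain ⟨N, hN⟩ : ∃ N : ℝ, N = t ^ (5 + 8 * m) * (covNum δ A : ℝ) ^ ((1 : ℝ) / 3) := ⟨_, rfl⟩
  rw [← hN] at hsmall
  have hNpos : 0 < N := by
    obtain ⟨u, hu⟩ := hEne
    exact (Nat.cast_nonneg _).trans_lt (hsmall u hu)
  have hNpow : N ^ 12 = t ^ (60 + 96 * m) * (covNum δ A : ℝ) ^ 4 := by
    rw [hN, mul_pow, ← pow_mul, ← Real.rpow_natCast (_ ^ ((1 : ℝ) / 3)),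
      ← Real.rpow_mul (Nat.cast_nonneg _), ← Real.rpow_natCast _ 4]
    norm_num
    left
    congr 1
    ring
  obtain ⟨Ω₀, hΩ₀⟩ : ∃ Ω₀ : Finset (Fin 9 → ℤ), ∀ z, z ∈ Ω₀ ↔ ∃ X ∈ A, rCell i δ X = z :=
    ⟨(finite_rCell_image (i := i) hδ fun X hX => (hA hX).2).toFinset, fun z => by simp⟩
  have hcov1 : covNum δ A ≤ Ω₀.card := covNum_le_card_rCell hδ (fun X hX => (hA hX).1)
    fun X hX => (hΩ₀ _).2 ⟨X, hX, rfl⟩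
  have hcov2 : (Ω₀.card : ℝ) ≤ q * covNum δ A := by
    rw [hq]
    exact card_rCell_le hδ (fun X hX => (hA hX).2) fun z hz => (hΩ₀ z).1 hz
  have hΩ₀ne : Ω₀.Nonempty := by
    rw [← Finset.card_pos]
    refine lt_of_lt_of_le (Nat.pos_of_ne_zero fun h0 => ?_) hcov1
    rw [h0] at hN
    norm_num at hN
    linarith
  obtain ⟨p, Ω, hpE, hpP, hpΩ, hΩcard⟩ := hsel t ht ht1 E hEsq hlt Ω₀ hΩ₀ne
    (fun u => Ω₀.filter fun z => ∃ X ∈ A' u, rCell i δ X = z) fun u hu =>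
    ⟨Finset.filter_subset _ _, by
      have h1 : covNum δ (A' u) ≤ (Ω₀.filter fun z => ∃ X ∈ A' u, rCell i δ X = z).card :=
        covNum_le_card_rCell (i := i) hδ (fun X hX => (hA (hA' u hu hX)).1) fun X hX =>
          Finset.mem_filter.2 ⟨(hΩ₀ _).2 ⟨X, hA' u hu hX, rfl⟩, X, hX, rfl⟩
      calc t / q * Ω₀.card ≤ t / q * (q * covNum δ A) := by gcongr
        _ = t * covNum δ A := by field_simp
        _ ≤ covNum δ (A' u) := hdense u hu
        _ ≤ _ := by exact_mod_cast h1⟩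
  have hrep : ∀ a, ∀ z ∈ Ω, ∃ X ∈ A' (p a), rCell i δ X = z := fun a z hz =>
    (Finset.mem_filter.1 (hpΩ a z hz)).2
  choose! X hXA hX using hrep
  have hbox : ∀ a, InBox (p a) := fun a => inBox_of_mem_uSq (hEsq (hpE a))
  choose T code hT hcodeT hcode using fun a =>
    exists_code hπ hδ ((hA' _ (hpE a)).trans hA) (hbox a)
  have hcell : ∀ a b, ∀ z ∈ Ω, ∀ j,
      |jet i (p a) j ⬝ᵥ (rCoord i (X b z) - rCoord i (X a z))| ≤ L * δ := by
    intro a b z hz j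
    refine hL _ (hbox a) j _ δ fun k => abs_sub_le_of_floor_div_eq hδ ?_
    exact congrFun ((hX b z hz).trans (hX a z hz).symm) k
  have hcore := hP p hbox (c * t ^ m) (by positivity)
    (mul_le_one₀ hc1 (by positivity) (pow_le_one₀ ht.le ht1)) hpP Ω
    (fun z => rCoord i (X (0, 0) z)) δ hδ (fun z hz z' hz' e => ?_)
    (fun a z => code a (X a z)) N hNpos (fun a => ?_) ?_
  · exact pow_exponents_absurd (n₀ := Ω₀.card) (n := Ω.card) (a := covNum δ A) hq1 hc0 hC1 ht ht1
      hκ hκ1 htκ (by exact_mod_cast hΩ₀ne.card_pos) (Nat.cast_nonneg _) (by exact_mod_cast hcov1)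
      (by simpa using hΩcard) (by rwa [hNpow] at hcore)
  · rw [← hX (0, 0) z hz, ← hX (0, 0) z' hz']
    exact e
  · have h1 : Ω.image (fun z => code a (X a z)) ⊆ T a :=
      Finset.image_subset_iff.2 fun z hz => hcodeT a _ (hXA a z hz)
    refine le_trans ?_ (hsmall _ (hpE a)).le
    rw [← hT a]
    exact Nat.cast_le.2 (le_trans (le_of_eq (by congr!)) (Finset.card_le_card h1))
  · intro a z hz z' hz' e j
    have h1 := hcode a _ (hXA a z' hz') _ (hXA a z hz) e j
    have h2 := hcell a (0, 0) z hz j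
    have h3 := hcell a (0, 0) z' hz' j
    simp only [dotProduct_sub] at h1 h2 h3 ⊢
    rw [abs_le] at h1 h2 h3 ⊢
    constructor <;> linarith

end ExceptionalSet

/-- subcritical estimate for the projections π^{(1)}_u, dim 𝔯ᵢ^{(1)} = 3. -/
theorem stmt6 (i : Fin 2) :
    ∃ M ε₀ : ℝ, 1 ≤ M ∧ 0 < ε₀ ∧
    ∃ δ₁ : ℝ → ℝ,
      (∀ ε : ℝ, 0 < ε → ε < ε₀ → δ₁ ε ∈ Set.Ioo (0:ℝ) 1) ∧
      ∀ ε : ℝ, 0 < ε → ε < ε₀ →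
      ∀ δ : ℝ, 0 < δ → δ ≤ δ₁ ε →
      ∀ A : Set M4, A ⊆ {X : M4 | X ∈ rSpace i ∧ mnorm X ≤ 1} →
      ∀ π : M4 → M4,
        (∀ X ∈ rSpace i, π X ∈ rUp i 1 ∧ ∀ Y ∈ rUp i 1, tinner (X - π X) Y = 0) →
        mU {p ∈ uSq | ∃ A' ⊆ A,
            δ ^ ε * (covNum δ A : ℝ) ≤ (covNum δ A' : ℝ) ∧
            ((covNum δ (π '' ((fun X => Adm (uMat i p.1 p.2) X) '' A')) : ℝ) <
              δ ^ (M * ε) * (covNum δ A : ℝ) ^ ((1:ℝ)/3))}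
          ≤ ENNReal.ofReal (δ ^ ε) := by
  obtain ⟨M, t₀, hM, ht₀, ht₀1, h⟩ := exists_mU_exceptional_le i
  refine ⟨M, 1, by exact_mod_cast hM, one_pos, fun ε => min (1 / 2) (t₀ ^ (1 / ε)), ?_, ?_⟩
  · exact fun ε _ _ => ⟨by positivity, (min_le_left _ _).trans_lt (by norm_num)⟩
  intro ε hε _ δ hδ hδ₁ A hA π hπ
  have ht : δ ^ ε ≤ t₀ := by
    calc δ ^ ε ≤ (t₀ ^ (1 / ε)) ^ ε :=
          Real.rpow_le_rpow hδ.le (hδ₁.trans (min_le_right _ _)) hε.le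
      _ = t₀ := by rw [← Real.rpow_mul ht₀.le, one_div_mul_cancel hε.ne', Real.rpow_one]
  have key := h (δ ^ ε) (by positivity) ht δ hδ A hA π hπ
  rwa [← Real.rpow_natCast, ← Real.rpow_mul hδ.le, mul_comm ε] at key
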